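/- Let X ⊂ int(𝔸) be an f-invariant essential annular continuum. Suppose ρ₊ ∈ ℝ is the upper prime end rotation number of the lift f̃ in X, in the sense that for all points x, y ∈ X̃ accessible from Ũ₊ one has k(f̃ⁿ(x), y)/n → ρ₊ as n → ∞. Then ρ₊ ∈ ρ_mes(f̃, X), i.e. there is an f-invariant Borel probability measure μ with supp(μ) ⊂ X and ρ(f̃, μ) = ρ₊. -/

import Mathlib

open Set Function MeasureTheory Filter Topology

noncomputable section

/-- The vertical fiber `[-1,1]`. -/
abbrev II : Set ℝ := Set.Icc (-1 : ℝ) 1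

/-- The universal cover `ℝ × [-1,1]` of the annulus. -/
abbrev Strip : Type := ℝ × II

/-- The compact annulus `(ℝ/ℤ) × [-1,1]`. -/
abbrev Ann : Type := AddCircle (1 : ℝ) × II

/-- The covering projection `π`. -/
def pr (z : Strip) : Ann := ((z.1 : AddCircle (1 : ℝ)), z.2)

/-- The deck transformation `T^k`. -/
def shiftPt (k : ℤ) (z : Strip) : Strip := (z.1 + k, z.2)

/-- `S + k`, the image of `S` under `T^k`. -/
def shiftSet (k : ℤ) (S : Set Strip) : Set Strip := shiftPt k '' S

/-- `f` is isotopic to the identity. -/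
def IsotopicToId (f : Ann → Ann) : Prop :=
  ∃ H : ℝ → Ann → Ann, Continuous (fun p : ℝ × Ann => H p.1 p.2) ∧
    (∀ t : ℝ, Function.Bijective (H t)) ∧ H 0 = id ∧ H 1 = f

/-- `F` is a lift of `f` commuting with the deck transformation. -/
def IsLift (f : Ann → Ann) (F : Strip → Strip) : Prop :=
  (∀ z, pr (F z) = f (pr z)) ∧ (∀ z, F (shiftPt 1 z) = shiftPt 1 (F z))

/-- `X` is an essential annular continuum with complementary components `Um`, `Up`. -/
structure IsEAC (X Um Up : Set Ann) : Prop where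
  compact : IsCompact X
  connected : IsConnected X
  inInterior : ∀ p ∈ X, ((p.2 : ℝ)) ∈ Set.Ioo (-1 : ℝ) 1
  hUm : Um = connectedComponentIn Xᶜ ((0 : AddCircle (1 : ℝ)), ⟨-1, le_rfl, by norm_num⟩)
  hUp : Up = connectedComponentIn Xᶜ ((0 : AddCircle (1 : ℝ)), ⟨1, by norm_num, le_rfl⟩)
  cover : Xᶜ = Um ∪ Up
  ne : Um ≠ Up

/-- An arc `γ : [0,1] → U ∪ {p}` with `γ([0,1)) ⊂ U` and `γ(1) = p`. -/
def IsArcTo (U : Set Strip) (γ : unitInterval → Strip) (p : Strip) : Prop :=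
  Continuous γ ∧ Function.Injective γ ∧ (∀ t, t ≠ 1 → γ t ∈ U) ∧ γ 1 = p

/-- `p` is accessible from `U`. -/
def AccFrom (U : Set Strip) (p : Strip) : Prop := ∃ γ, IsArcTo U γ p

/-- The order `≺` on accessible points, with access arcs starting on `ℝ × {b}`. -/
def PrecB (b : ℝ) (U : Set Strip) (x x' : Strip) : Prop :=
  ∃ γ γ' : unitInterval → Strip,
    IsArcTo U γ x ∧ IsArcTo U γ' x' ∧
    ((γ 0).2 : ℝ) = b ∧ ((γ' 0).2 : ℝ) = b ∧
    Disjoint (range γ) (range γ') ∧ (γ 0).1 < (γ' 0).1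

/-- `k = k(x,y)` is the unique integer with `T^k(y) ⪯ x ≺ T^{k+1}(y)`. -/
def AccIdxB (b : ℝ) (U : Set Strip) (x y : Strip) (k : ℤ) : Prop :=
  (shiftPt k y = x ∨ PrecB b U (shiftPt k y) x) ∧ PrecB b U x (shiftPt (k + 1) y)

/-- `ρ` is the prime end rotation number of the lift `F` as seen from `U`
(access arcs starting at height `b`): `k(Fⁿ(x), y)/n → ρ` for all accessible `x, y`. -/
def PrimeEndRotB (b : ℝ) (U Xt : Set Strip) (F : Strip → Strip) (ρ : ℝ) : Prop :=
  ∀ x ∈ Xt, ∀ y ∈ Xt, AccFrom U x → AccFrom U y →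
    ∀ k : ℕ → ℤ, (∀ n : ℕ, AccIdxB b U (F^[n] x) y (k n)) →
      Tendsto (fun n : ℕ => (k n : ℝ) / (n : ℝ)) atTop (𝓝 ρ)

/-- The measure-theoretic rotation set `ρ_mes(g̃, X)`, where `φ` is the displacement
function of the lift `g̃` (pushed down to the annulus). -/
def rotMes (g : Ann → Ann) (φ : Ann → ℝ) (X : Set Ann) : Set ℝ :=
  {r | ∃ μ : Measure Ann, IsProbabilityMeasure μ ∧ Measure.map g μ = μ ∧
    μ Xᶜ = 0 ∧ ∫ a, φ a ∂μ = r}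

/-- A point in the interior of the top boundary segment `(0,1) × {1}`. -/
def topSeg : Strip := ((1 : ℝ) / 2, ⟨1, by norm_num, le_rfl⟩)

/-- `β' = β ∖ {x₀} = {0} × (η, 1]`. -/
def betaP (η : ℝ) : Set Strip := {z : Strip | z.1 = 0 ∧ η < (z.2 : ℝ)}

/-- `η = max{y : (0,y) ∈ X̃}`. -/
def etaSpec (Xt : Set Strip) (η : ℝ) : Prop :=
  IsGreatest {y : ℝ | ∃ z ∈ Xt, z.1 = 0 ∧ (z.2 : ℝ) = y} η

/-- The fundamental region `V`: the closure, relative to `Ũ₊`, of the connected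
component of `Ũ₊ ∖ (β' ∪ (β' + 1))` containing the segment `(0,1) × {1}`. -/
def Vset (Utp : Set Strip) (η : ℝ) : Set Strip :=
  Utp ∩ closure (connectedComponentIn (Utp \ (betaP η ∪ shiftSet 1 (betaP η))) topSeg)

/-- A hair of `W`: an arc in `W` starting on `ℝ × {1}`. -/
def IsHair (W : Set Strip) (γ : unitInterval → Strip) : Prop :=
  Continuous γ ∧ Function.Injective γ ∧ ((γ 0).2 : ℝ) = 1 ∧ ∀ t, γ t ∈ W

/-- `(γ)₁`, the projection of the image of `γ` to the first coordinate. -/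
def proj1 (γ : unitInterval → Strip) : Set ℝ := range fun t => (γ t).1

/-- `(V + k)⁻ = ⋃_{j ≤ k} (V + j)`. -/
def VMinus (k : ℤ) (V : Set Strip) : Set Strip := ⋃ j ∈ Iic k, shiftSet j V

/-- `(V + k)⁺ = ⋃_{j ≥ k} (V + j)`. -/
def VPlus (k : ℤ) (V : Set Strip) : Set Strip := ⋃ j ∈ Ici k, shiftSet j V

/-- A crosscut of `Ũ₊`: an arc with endpoints on `X̃` and interior in `Ũ₊`. -/
def IsCrosscut (Utp Xt : Set Strip) (c : unitInterval → Strip) : Prop :=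
  Continuous c ∧ Function.Injective c ∧ c 0 ∈ Xt ∧ c 1 ∈ Xt ∧
    ∀ t, t ≠ 0 → t ≠ 1 → c t ∈ Utp

/-- `F^n` for `n : ℤ`. -/
def iterZ (F : Strip ≃ₜ Strip) (n : ℤ) : Strip → Strip := fun z => (F.toEquiv ^ n) z

end


lemma rect_preconn (I J : Set ℝ) (hI : I.OrdConnected) (hJ : J.OrdConnected) :
    IsPreconnected {z : Strip | z.1 ∈ I ∧ (z.2 : ℝ) ∈ J} := by
  have h2 : IsPreconnected ((Subtype.val : II → ℝ) ⁻¹' J) := by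
    rw [← Topology.IsInducing.subtypeVal.isPreconnected_image, Subtype.image_preimage_coe]
    exact isPreconnected_iff_ordConnected.2 (ordConnected_Icc.inter hJ)
  have := (isPreconnected_iff_ordConnected.2 hI).prod h2
  exact this

lemma projIcc_quot : Topology.IsQuotientMap (projIcc (-1:ℝ) 1 (by norm_num)) := by
  refine Topology.IsQuotientMap.of_inverse (f := (Subtype.val : II → ℝ)) continuous_subtype_val continuous_projIcc ?_
  intro x
  exact projIcc_val _ x

instance instLPC_II : LocallyPathConnectedSpace II := projIcc_quot.locallyPathConnectedSpace
instance instLC_II : LocallyConnectedSpace II := inferInstance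
instance instLPC_C : LocallyPathConnectedSpace (AddCircle (1:ℝ)) :=
  (QuotientAddGroup.isQuotientMap_mk (G := ℝ) _).locallyPathConnectedSpace
instance instLC_Strip : LocallyConnectedSpace Strip := inferInstance
instance instLC_Ann : LocallyConnectedSpace Ann := inferInstance
lemma conn_II : ConnectedSpace II := Subtype.connectedSpace ⟨⟨0, by simp⟩, isPreconnected_Icc⟩
instance instC_II : ConnectedSpace II := conn_II
instance instC_Strip : ConnectedSpace Strip := inferInstance
instance instC_Ann : ConnectedSpace Ann := inferInstance

lemma pr_cont : Continuous pr := by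
  unfold pr; fun_prop
lemma pr_open : IsOpenMap pr := by
  exact (QuotientAddGroup.isOpenMap_coe).prodMap IsOpenMap.id
lemma pr_surj : Surjective pr := by
  rintro ⟨a, b⟩
  obtain ⟨x, rfl⟩ := QuotientAddGroup.mk_surjective a
  exact ⟨(x, b), rfl⟩
lemma pr_shift (k : ℤ) (z : Strip) : pr (shiftPt k z) = pr z := by
  unfold pr shiftPt
  ext <;> simp
lemma pr_eq {z w : Strip} (h : pr z = pr w) : ∃ k : ℤ, w = shiftPt k z := by
  unfold pr at h
  rw [Prod.mk.injEq, eq_comm, QuotientAddGroup.eq] at h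
  obtain ⟨h1, h2⟩ := h
  obtain ⟨k, hk⟩ := AddSubgroup.mem_zmultiples_iff.1 h1
  refine ⟨-k, ?_⟩
  unfold shiftPt
  ext
  · simp at hk ⊢; linarith
  · simp [h2]
lemma shift_cont (k : ℤ) : Continuous (shiftPt k) := by unfold shiftPt; fun_prop
lemma shift_add (k m : ℤ) (z : Strip) : shiftPt k (shiftPt m z) = shiftPt (k+m) z := by
  unfold shiftPt; ext <;> simp; ring
lemma shift_zero (z : Strip) : shiftPt 0 z = z := by
  unfold shiftPt; ext <;> simp
def shiftH (k : ℤ) : Strip ≃ₜ Strip where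
  toFun := shiftPt k
  invFun := shiftPt (-k)
  left_inv z := by rw [shift_add]; simp [shift_zero]
  right_inv z := by rw [shift_add]; simp [shift_zero]
  continuous_toFun := shift_cont k
  continuous_invFun := shift_cont (-k)

/-- complex coordinate -/
def cx (z : Strip) : ℂ := ⟨z.1, z.2⟩
@[simp] lemma cx_re (z : Strip) : (cx z).re = z.1 := rfl
@[simp] lemma cx_im (z : Strip) : (cx z).im = z.2 := rfl
lemma cx_cont : Continuous cx := by
  have : cx = fun z => ((z.1 : ℝ) : ℂ) + ((z.2 : ℝ) : ℂ) * Complex.I := by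
    funext z; apply Complex.ext <;> simp [cx]
  rw [this]; fun_prop
lemma cx_inj : Injective cx := by
  intro z w h
  have h1 := congrArg Complex.re h
  have h2 := congrArg Complex.im h
  simp at h1 h2
  exact Prod.ext h1 (Subtype.ext h2)
lemma cx_sub_ne {z w : Strip} (h : z ≠ w) : cx z - cx w ≠ 0 := sub_ne_zero.2 (fun h' => h (cx_inj h'))
lemma cx_norm_ge (z w : Strip) : dist z w ≤ ‖cx z - cx w‖ := by
  rw [Prod.dist_eq]
  apply max_le
  · have := Complex.abs_re_le_norm (cx z - cx w); simpa [Real.dist_eq] using this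
  · have := Complex.abs_im_le_norm (cx z - cx w); simpa [Subtype.dist_eq, Real.dist_eq] using this

/-- existence of logarithm -/
def HasLog {α : Type*} [TopologicalSpace α] (K : Set α) (u : α → ℂ) : Prop :=
  ∃ g : α → ℂ, ContinuousOn g K ∧ ∀ z ∈ K, Complex.exp (g z) = u z

lemma log_const {α : Type*} [TopologicalSpace α] {K : Set α} (hK : IsPreconnected K)
    {g h : α → ℂ} (hg : ContinuousOn g K) (hh : ContinuousOn h K)
    (e : ∀ z ∈ K, Complex.exp (g z) = Complex.exp (h z)) {z w : α} (hz : z ∈ K) (hw : w ∈ K) :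
    g z - h z = g w - h w := by
  -- integer valued
  have key : ∀ x ∈ K, ∃ n : ℤ, g x - h x = n * (2 * Real.pi * Complex.I) := by
    intro x hx
    obtain ⟨n, hn⟩ := Complex.exp_eq_exp_iff_exists_int.1 (e x hx)
    exact ⟨n, by rw [hn]; ring⟩
  have hc : ContinuousOn (fun x => (g x - h x).im / (2 * Real.pi)) K :=
    (Complex.continuous_im.comp_continuousOn (hg.sub hh)).div_const _
  have hintg : ∀ x ∈ K, ∃ n : ℤ, (g x - h x).im / (2 * Real.pi) = n := by
    intro x hx
    obtain ⟨n, hn⟩ := key x hx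
    refine ⟨n, ?_⟩
    rw [hn]; simp
  have hpc := hK.image _ hc
  have : (g z - h z).im / (2 * Real.pi) = (g w - h w).im / (2 * Real.pi) := by
    by_contra hne
    obtain ⟨n, hn⟩ := hintg z hz
    obtain ⟨m, hm⟩ := hintg w hw
    have hoc := hpc.ordConnected
    have hA := mem_image_of_mem (fun x => (g x - h x).im / (2 * Real.pi)) hz
    have hB := mem_image_of_mem (fun x => (g x - h x).im / (2 * Real.pi)) hw
    simp only [hn, hm] at hA hB hne
    have hnm : n ≠ m := fun h => hne (by rw [h])
    rcases lt_or_gt_of_ne hnm with hlt | hlt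
    · have : ((n:ℝ) + 1/2) ∈ (fun x => (g x - h x).im / (2 * Real.pi)) '' K := by
        have h1 : (n:ℝ) + 1 ≤ m := by exact_mod_cast hlt
        apply hoc.out hA hB; constructor <;> linarith
      obtain ⟨x, hx, hxe⟩ := this
      obtain ⟨l, hl⟩ := hintg x hx
      simp only [hl] at hxe
      have h1 : ((2 * l : ℤ) : ℝ) = ((2 * n + 1 : ℤ):ℝ) := by push_cast; linarith
      have := Int.cast_injective h1
      omega
    · have : ((m:ℝ) + 1/2) ∈ (fun x => (g x - h x).im / (2 * Real.pi)) '' K := by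
        have h1 : (m:ℝ) + 1 ≤ n := by exact_mod_cast hlt
        apply hoc.out hB hA; constructor <;> linarith
      obtain ⟨x, hx, hxe⟩ := this
      obtain ⟨l, hl⟩ := hintg x hx
      simp only [hl] at hxe
      have h1 : ((2 * l : ℤ) : ℝ) = ((2 * m + 1 : ℤ):ℝ) := by push_cast; linarith
      have := Int.cast_injective h1
      omega
  obtain ⟨n, hn⟩ := key z hz
  obtain ⟨m, hm⟩ := key w hw
  rw [hn, hm] at this ⊢
  simp at this
  rw [this]

lemma slit_div {a b : ℂ} (h : ‖b - a‖ < ‖a‖) : b / a ∈ Complex.slitPlane := by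
  have ha : a ≠ 0 := by rintro rfl; simp at h; linarith [norm_nonneg b]
  have : b / a = 1 + (b - a) / a := by field_simp; ring
  rw [this]
  apply Complex.mem_slitPlane_of_norm_lt_one
  rw [norm_div, div_lt_one (norm_pos_iff.2 ha)]
  exact h

lemma perturb' {α : Type*} [TopologicalSpace α] {K : Set α} {u v : α → ℂ} (hu : ContinuousOn u K)
    (hv : ContinuousOn v K) (h0 : ∀ z ∈ K, u z ≠ 0)
    (h : ∀ z ∈ K, v z / u z ∈ Complex.slitPlane) (hl : HasLog K u) : HasLog K v := by
  obtain ⟨g, hg, he⟩ := hl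
  refine ⟨fun z => g z + Complex.log (v z / u z), ?_, ?_⟩
  · exact hg.add ((hv.div hu h0).clog h)
  · intro z hz
    rw [Complex.exp_add, he z hz, Complex.exp_log (Complex.slitPlane_ne_zero (h z hz))]
    have := h0 z hz
    field_simp

lemma perturb {α : Type*} [TopologicalSpace α] {K : Set α} {u v : α → ℂ} (hu : ContinuousOn u K)
    (hv : ContinuousOn v K) (h : ∀ z ∈ K, ‖v z - u z‖ < ‖u z‖) (hl : HasLog K u) : HasLog K v := by
  refine perturb' hu hv ?_ (fun z hz => slit_div (h z hz)) hl
  intro z hz h0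
  have := h z hz
  rw [h0] at this; simp at this; linarith [norm_nonneg (v z)]

lemma HasLog.mono {α : Type*} [TopologicalSpace α] {K K' : Set α} {u : α → ℂ} (h : HasLog K u) (hs : K' ⊆ K) :
    HasLog K' u := by
  obtain ⟨g, hg, he⟩ := h
  exact ⟨g, hg.mono hs, fun z hz => he z (hs hz)⟩

lemma HasLog.of_slit {α : Type*} [TopologicalSpace α] {K : Set α} {u : α → ℂ} (c : ℂ) (hc : c ≠ 0)
    (hu : ContinuousOn u K) (h : ∀ z ∈ K, c * u z ∈ Complex.slitPlane) : HasLog K u := by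
  refine ⟨fun z => Complex.log (c * u z) - Complex.log c, ?_, ?_⟩
  · exact ((continuousOn_const.mul hu).clog h).sub continuousOn_const
  · intro z hz
    rw [Complex.exp_sub, Complex.exp_log (Complex.slitPlane_ne_zero (h z hz)), Complex.exp_log hc]
    field_simp

lemma global_log (u : Strip → ℂ) (hu : Continuous u) (h0 : ∀ z, u z ≠ 0) :
    ∃ g : Strip → ℂ, Continuous g ∧ ∀ z, Complex.exp (g z) = u z := by
  let r : ℂ → Strip := fun w => (w.re, projIcc (-1:ℝ) 1 (by norm_num) w.im)
  have hr : Continuous r := by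
    refine Complex.continuous_re.prodMk (continuous_projIcc.comp Complex.continuous_im)
  have hrc : ∀ z, r (cx z) = z := by
    intro z; ext <;> simp [r]
  let U : C(ℂ, ℂ) := ⟨fun w => u (r w), hu.comp hr⟩
  obtain ⟨G, ⟨_, hG⟩, -⟩ := Complex.isCoveringMapOn_exp.existsUnique_continuousMap_lifts U
    (a₀ := 0) (e₀ := Complex.log (u (r 0))) (by simp [U, Complex.exp_log (h0 _)]) (fun a => by simpa [U] using h0 _)
  refine ⟨fun z => G (cx z), G.continuous.comp cx_cont, fun z => ?_⟩
  have := congrFun hG (cx z)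
  simp only [comp_apply, U, ContinuousMap.coe_mk, hrc] at this
  exact this

lemma unicoh {A B : Set Strip} (hA : IsOpen A) (hB : IsOpen B) (cA : IsPreconnected A)
    (cB : IsPreconnected B) (hAB : A ∪ B = univ) : IsPreconnected (A ∩ B) := by
  rw [isPreconnected_iff_subset_of_disjoint]
  intro P' Q' hP' hQ' hsub hdis
  by_contra hcon
  push Not at hcon
  obtain ⟨hP0, hQ0⟩ := hcon
  set P := A ∩ B ∩ P' with hPdef
  set Q := A ∩ B ∩ Q' with hQdef
  have hP : IsOpen P := (hA.inter hB).inter hP'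
  have hQ : IsOpen Q := (hA.inter hB).inter hQ'
  have hPQ : P ∩ Q = ∅ := by
    rw [eq_empty_iff_forall_notMem]; intro x ⟨h1, h2⟩
    have : x ∈ A ∩ B ∩ (P' ∩ Q') := ⟨h1.1, h1.2, h2.2⟩
    rw [hdis] at this; exact this
  have hPUQ : ∀ x ∈ A, x ∈ B → x ∈ P ∨ x ∈ Q := by
    intro x h1 h2
    rcases hsub ⟨h1, h2⟩ with h | h
    · exact Or.inl ⟨⟨h1, h2⟩, h⟩
    · exact Or.inr ⟨⟨h1, h2⟩, h⟩
  obtain ⟨q, hqAB, hq⟩ := not_subset.1 hP0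
  obtain ⟨p, hpAB, hp⟩ := not_subset.1 hQ0
  have hpP : p ∈ P := (hPUQ p hpAB.1 hpAB.2).resolve_right (fun h => hp h.2)
  have hqQ : q ∈ Q := (hPUQ q hqAB.1 hqAB.2).resolve_left (fun h => hq h.2)
  -- Urysohn: ρ = 0 on Bᶜ-nbhd?  closed sets Aᶜ, Bᶜ disjoint
  have hd : Disjoint Bᶜ Aᶜ := by
    rw [Set.disjoint_left]; intro x hx hx'
    have : x ∈ A ∪ B := hAB ▸ mem_univ x
    rcases this with h | h
    · exact hx' h
    · exact hx h
  obtain ⟨r, hr0, hr1, -⟩ := exists_continuous_zero_one_of_isClosed hB.isClosed_compl hA.isClosed_compl hd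
  classical
  -- a on A: r on P, 0 elsewhere;  b on B: r - 1 on P, 0 elsewhere
  let a : Strip → ℂ := fun x => if x ∈ P then ((r x : ℝ) : ℂ) else 0
  let b : Strip → ℂ := fun x => if x ∈ P then ((r x - 1 : ℝ) : ℂ) else 0
  have hrc : Continuous (fun x => ((r x : ℝ) : ℂ)) := by fun_prop
  have hrc' : Continuous (fun x => ((r x - 1: ℝ) : ℂ)) := by fun_prop
  have ha : ContinuousOn a A := by
    intro x hx
    by_cases hxP : x ∈ P
    · apply ContinuousAt.continuousWithinAt
      apply hrc.continuousAt.congr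
      filter_upwards [hP.mem_nhds hxP] with y hy
      simp [a, hy]
    · have hax : a x = 0 := by simp [a, hxP]
      by_cases hxB : x ∈ B
      · have hxQ := (hPUQ x hx hxB).resolve_left hxP
        apply ContinuousAt.continuousWithinAt
        apply (continuousAt_const (y := (0:ℂ))).congr
        filter_upwards [hQ.mem_nhds hxQ] with y hy
        have : y ∉ P := fun h => by
          have : y ∈ P ∩ Q := ⟨h, hy⟩
          rw [hPQ] at this; exact this
        simp [a, this]
      · unfold ContinuousWithinAt
        rw [hax]
        have h0 : r x = 0 := hr0 hxB
        have ht : Tendsto (fun y => ((r y : ℝ) : ℂ)) (𝓝[A] x) (𝓝 0) := by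
          have := (hrc.tendsto x).mono_left (nhdsWithin_le_nhds (s := A))
          simpa [h0] using this
        apply squeeze_zero_norm (a := fun y => ‖((r y : ℝ) : ℂ)‖)
        · intro y; by_cases hy : y ∈ P <;> simp [a, hy]
        · simpa using ht.norm
  have hb : ContinuousOn b B := by
    intro x hx
    by_cases hxP : x ∈ P
    · apply ContinuousAt.continuousWithinAt
      apply hrc'.continuousAt.congr
      filter_upwards [hP.mem_nhds hxP] with y hy
      simp [b, hy]
    · have hax : b x = 0 := by simp [b, hxP]
      by_cases hxA : x ∈ A
      · have hxQ := (hPUQ x hxA hx).resolve_left hxP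
        apply ContinuousAt.continuousWithinAt
        apply (continuousAt_const (y := (0:ℂ))).congr
        filter_upwards [hQ.mem_nhds hxQ] with y hy
        have : y ∉ P := fun h => by
          have : y ∈ P ∩ Q := ⟨h, hy⟩
          rw [hPQ] at this; exact this
        simp [b, this]
      · unfold ContinuousWithinAt
        rw [hax]
        have h0 : r x = 1 := hr1 hxA
        have ht : Tendsto (fun y => ((r y - 1 : ℝ) : ℂ)) (𝓝[B] x) (𝓝 0) := by
          have := (hrc'.tendsto x).mono_left (nhdsWithin_le_nhds (s := B))
          simpa [h0] using this
        apply squeeze_zero_norm (a := fun y => ‖((r y - 1 : ℝ) : ℂ)‖)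
        · intro y
          by_cases hy : y ∈ P
          · simp [b, hy]
          · simp only [b, hy]; simp
        · simpa using ht.norm
  let w : ℂ := 2 * Real.pi * Complex.I
  let u : Strip → ℂ := fun x => if x ∈ A then Complex.exp (a x * w) else Complex.exp (b x * w)
  have hab : ∀ x ∈ A, x ∈ B → Complex.exp (a x * w) = Complex.exp (b x * w) := by
    intro x h1 h2
    by_cases hxP : x ∈ P
    · simp only [a, b, hxP, if_true]
      push_cast
      rw [sub_mul, one_mul, Complex.exp_sub]
      simp [w, Complex.exp_two_pi_mul_I]
    · simp [a, b, hxP]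
  have huA : ∀ x ∈ A, u x = Complex.exp (a x * w) := fun x hx => by simp [u, hx]
  have huB : ∀ x ∈ B, u x = Complex.exp (b x * w) := fun x hx => by
    by_cases h : x ∈ A
    · rw [huA x h, hab x h hx]
    · simp [u, h]
  have hu : Continuous u := by
    rw [continuous_iff_continuousAt]
    intro x
    have : x ∈ A ∪ B := hAB ▸ mem_univ x
    rcases this with h | h
    · have h1 : ContinuousAt (fun x => Complex.exp (a x * w)) x :=
        Complex.continuous_exp.continuousAt.comp ((ha.continuousAt (hA.mem_nhds h)).mul continuousAt_const)
      apply h1.congr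
      filter_upwards [hA.mem_nhds h] with y hy using (huA y hy).symm
    · have h1 : ContinuousAt (fun x => Complex.exp (b x * w)) x :=
        Complex.continuous_exp.continuousAt.comp ((hb.continuousAt (hB.mem_nhds h)).mul continuousAt_const)
      apply h1.congr
      filter_upwards [hB.mem_nhds h] with y hy using (huB y hy).symm
  obtain ⟨g, hg, hge⟩ := global_log u hu (fun z => by by_cases h : z ∈ A <;> simp [u, h, Complex.exp_ne_zero])
  have e1 := log_const cA (h := fun z => a z * w) hg.continuousOn (ha.mul continuousOn_const)
    (fun z hz => by rw [hge, huA z hz]) hpAB.1 hqAB.1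
  have e2 := log_const cB (h := fun z => b z * w) hg.continuousOn (hb.mul continuousOn_const)
    (fun z hz => by rw [hge, huB z hz]) hpAB.2 hqAB.2
  have hqP : q ∉ P := fun h => by
    have : q ∈ P ∩ Q := ⟨h, hqQ⟩
    rw [hPQ] at this; exact this
  simp only [a, b, hpP, hqP, if_true, if_false] at e1 e2
  have : w = 0 := by
    push_cast at e1 e2
    linear_combination e2 - e1
  simp [w] at this


lemma isOpen_diff_comp {α : Type*} [TopologicalSpace α] [LocallyConnectedSpace α] {V : Set α} (hV : IsOpen V) (x : α) :
    IsOpen (V \ connectedComponentIn V x) := by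
  rw [isOpen_iff_forall_mem_open]
  rintro y ⟨hy, hyx⟩
  refine ⟨connectedComponentIn V y, ?_, hV.connectedComponentIn, mem_connectedComponentIn hy⟩
  intro z hz
  refine ⟨connectedComponentIn_subset _ _ hz, fun hzx => hyx ?_⟩
  rw [connectedComponentIn_eq hzx, ← connectedComponentIn_eq hz]
  exact mem_connectedComponentIn hy

lemma comp_disj {α : Type*} [TopologicalSpace α] {V : Set α} {x y : α}
    (h : connectedComponentIn V x ≠ connectedComponentIn V y) :
    Disjoint (connectedComponentIn V x) (connectedComponentIn V y) := by
  rw [Set.disjoint_left]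
  intro z h1 h2
  exact h ((connectedComponentIn_eq h1).trans (connectedComponentIn_eq h2).symm)

lemma line_preconn (b : II) : IsPreconnected {z : Strip | z.2 = b} := by
  have := rect_preconn univ {(b:ℝ)} ordConnected_univ ordConnected_singleton
  convert this using 2
  ext z; simp [Subtype.ext_iff]

lemma lift_preconn {W : Set Ann} (hW : IsOpen W) (cW : IsPreconnected W) (b : II)
    (hb : ∀ a, (a, b) ∈ W) : IsPreconnected (pr ⁻¹' W) := by
  have hWo : IsOpen (pr ⁻¹' W) := hW.preimage pr_cont
  set C := connectedComponentIn (pr ⁻¹' W) ((0:ℝ), b) with hC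
  have hl : {z : Strip | z.2 = b} ⊆ C := by
    apply (line_preconn b).subset_connectedComponentIn
    · simp
    · rintro ⟨x, y⟩ h
      simp only [mem_ofPred_eq] at h
      subst h
      exact hb _
  have hCs : C ⊆ pr ⁻¹' W := connectedComponentIn_subset _ _
  suffices h : pr ⁻¹' W ⊆ C by
    have : pr ⁻¹' W = C := h.antisymm hCs
    rw [this]; exact isPreconnected_connectedComponentIn
  intro z hz
  by_contra hzC
  have h1 : IsOpen (pr '' C) := pr_open _ hWo.connectedComponentIn
  have h2 : IsOpen (pr '' (pr ⁻¹' W \ C)) := pr_open _ (isOpen_diff_comp hWo _)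
  obtain ⟨w, hw, ⟨c, hc, hcw⟩, ⟨d, hd, hdw⟩⟩ := cW _ _ h1 h2 (by
      intro w hw
      obtain ⟨y, rfl⟩ := pr_surj w
      by_cases hy : y ∈ C
      · exact Or.inl ⟨y, hy, rfl⟩
      · exact Or.inr ⟨y, ⟨hw, hy⟩, rfl⟩)
    ⟨pr (0, b), hb _, ⟨(0,b), hl rfl, rfl⟩⟩ ⟨pr z, hz, ⟨z, ⟨hz, hzC⟩, rfl⟩⟩
  obtain ⟨k, hk⟩ := pr_eq (hcw.trans hdw.symm)
  apply hd.2
  rw [hk]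
  have : shiftPt k '' C ⊆ C := by
    have hp : IsPreconnected (shiftPt k '' C) :=
      isPreconnected_connectedComponentIn.image _ (shift_cont k).continuousOn
    have hm : ((0:ℝ) + k, b) ∈ shiftPt k '' C := ⟨((0:ℝ), b), hl rfl, rfl⟩
    have hs : shiftPt k '' C ⊆ pr ⁻¹' W := by
      rintro _ ⟨y, hy, rfl⟩
      show pr _ ∈ W
      rw [pr_shift]; exact hCs hy
    have e := hp.subset_connectedComponentIn hm hs
    rwa [← connectedComponentIn_eq (show ((0:ℝ) + k, b) ∈ connectedComponentIn (pr ⁻¹' W) ((0:ℝ), b) from hl rfl)] at e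
  exact this ⟨c, hc, rfl⟩

abbrev tp : II := ⟨1, by norm_num, le_rfl⟩
abbrev bt : II := ⟨-1, le_rfl, by norm_num⟩

section ctx
variable {X Um Up : Set Ann}

lemma IsEAC.circ_top (h : IsEAC X Um Up) (a : AddCircle (1:ℝ)) : (a, tp) ∈ Up := by
  have hp : IsPreconnected (pr '' {z : Strip | z.2 = tp}) := (line_preconn tp).image _ pr_cont.continuousOn
  rw [h.hUp]
  refine hp.subset_connectedComponentIn (x := ((0 : AddCircle (1 : ℝ)), tp)) ⟨(0, tp), rfl, by simp [pr]⟩ ?_ ?_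
  · rintro _ ⟨z, hz, rfl⟩ hx
    have := (h.inInterior _ hx).2
    simp only [mem_ofPred_eq] at hz
    simp [pr, hz] at this
  · obtain ⟨z, hz⟩ := pr_surj (a, tp)
    refine ⟨z, ?_, hz⟩
    have := congrArg Prod.snd hz
    simpa [pr] using this
lemma IsEAC.circ_bot (h : IsEAC X Um Up) (a : AddCircle (1:ℝ)) : (a, bt) ∈ Um := by
  have hp : IsPreconnected (pr '' {z : Strip | z.2 = bt}) := (line_preconn bt).image _ pr_cont.continuousOn
  rw [h.hUm]
  refine hp.subset_connectedComponentIn (x := ((0 : AddCircle (1 : ℝ)), bt)) ⟨(0, bt), rfl, by simp [pr]⟩ ?_ ?_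
  · rintro _ ⟨z, hz, rfl⟩ hx
    have := (h.inInterior _ hx).1
    simp only [mem_ofPred_eq] at hz
    simp [pr, hz] at this
  · obtain ⟨z, hz⟩ := pr_surj (a, bt)
    refine ⟨z, ?_, hz⟩
    have := congrArg Prod.snd hz
    simpa [pr] using this
lemma IsEAC.openX (h : IsEAC X Um Up) : IsOpen Xᶜ := h.compact.isClosed.isOpen_compl
lemma IsEAC.openUp (h : IsEAC X Um Up) : IsOpen Up := by
  rw [h.hUp]; exact h.openX.connectedComponentIn
lemma IsEAC.openUm (h : IsEAC X Um Up) : IsOpen Um := by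
  rw [h.hUm]; exact h.openX.connectedComponentIn
lemma IsEAC.conUp (h : IsEAC X Um Up) : IsPreconnected Up := by
  rw [h.hUp]; exact isPreconnected_connectedComponentIn
lemma IsEAC.conUm (h : IsEAC X Um Up) : IsPreconnected Um := by
  rw [h.hUm]; exact isPreconnected_connectedComponentIn
lemma IsEAC.disj (h : IsEAC X Um Up) : Disjoint Um Up := by
  have := h.ne
  rw [h.hUm, h.hUp] at this ⊢
  exact comp_disj this
lemma IsEAC.compl (h : IsEAC X Um Up) : Upᶜ = X ∪ Um := by
  ext a
  have h1 := h.cover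
  have h2 : a ∈ Xᶜ ↔ a ∈ Um ∪ Up := by rw [h1]
  have h3 : a ∈ Um → a ∉ Up := fun h' => Set.disjoint_left.1 h.disj h'
  simp only [mem_compl_iff, mem_union] at h2 ⊢
  tauto
lemma IsEAC.notX_of_Up (h : IsEAC X Um Up) {a : Ann} (ha : a ∈ Up) : a ∉ X := by
  intro hx
  have : a ∈ Upᶜ := by rw [h.compl]; exact Or.inl hx
  exact this ha
lemma IsEAC.conXUm (h : IsEAC X Um Up) : IsPreconnected (X ∪ Um) := by
  have hne : (closure Um ∩ X).Nonempty := by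
    by_contra hcon
    rw [not_nonempty_iff_eq_empty] at hcon
    have hcl : closure Um ⊆ Um := by
      intro a ha
      have hx : a ∈ Xᶜ := fun hx => by
        have : a ∈ closure Um ∩ X := ⟨ha, hx⟩
        rw [hcon] at this; exact this
      rw [h.cover] at hx
      rcases hx with hx | hx
      · exact hx
      · exfalso
        obtain ⟨b, h1, h2⟩ := mem_closure_iff.1 ha _ h.openUp hx
        exact Set.disjoint_left.1 h.disj h2 h1
    have hclop : IsClopen Um := ⟨isClosed_of_closure_subset hcl, h.openUm⟩
    have := hclop.eq_univ ⟨_, h.circ_bot 0⟩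
    exact Set.disjoint_left.1 h.disj (this ▸ mem_univ _) (h.circ_top 0)
  obtain ⟨x, hx1, hx2⟩ := hne
  have h1 : IsPreconnected (insert x Um) := by
    apply h.conUm.subset_closure (subset_insert _ _)
    exact insert_subset hx1 subset_closure
  have h2 := IsPreconnected.union x hx2 (mem_insert _ _) h.connected.isPreconnected h1
  convert h2 using 1
  ext a; simp only [mem_union, mem_insert_iff]
  constructor
  · tauto
  · rintro (h | rfl | h)
    · exact Or.inl h
    · exact Or.inl hx2
    · exact Or.inr h

lemma IsEAC.conU (h : IsEAC X Um Up) : IsPreconnected (pr ⁻¹' Up) :=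
  lift_preconn h.openUp h.conUp tp h.circ_top
lemma IsEAC.oU (h : IsEAC X Um Up) : IsOpen (pr ⁻¹' Up) := h.openUp.preimage pr_cont
lemma IsEAC.topU (h : IsEAC X Um Up) {z : Strip} (hz : (z.2:ℝ) = 1) : z ∈ pr ⁻¹' Up := by
  have : z = (z.1, tp) := Prod.ext rfl (Subtype.ext hz)
  rw [this]; exact h.circ_top _

/-- collar lemma -/
lemma IsEAC.collar (h : IsEAC X Um Up) {O : Set Ann} (hO : IsOpen O) (hXO : X ⊆ O) :
    ∃ C : Set Ann, IsOpen C ∧ C ⊆ Up ∩ O ∧ IsPreconnected (pr ⁻¹' C) ∧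
      ∀ x ∈ X, ∀ᶠ a in 𝓝 x, a ∈ Up → a ∈ C := by
  have hO1 : IsOpen (Um ∪ O) := h.openUm.union hO
  set O' := connectedComponentIn (Um ∪ O) ((0 : AddCircle (1 : ℝ)), bt) with hO'
  have hs : X ∪ Um ⊆ O' := by
    apply h.conXUm.subset_connectedComponentIn
    · exact Or.inr (h.circ_bot 0)
    · rintro a (ha | ha)
      · exact Or.inr (hXO ha)
      · exact Or.inl ha
  have hO'o : IsOpen O' := hO1.connectedComponentIn
  have hc : IsPreconnected (pr ⁻¹' O') := lift_preconn hO'o isPreconnected_connectedComponentIn bt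
    (fun a => hs (Or.inr (h.circ_bot a)))
  have hu : pr ⁻¹' Up ∪ pr ⁻¹' O' = univ := by
    ext z; simp only [mem_union, mem_preimage, mem_univ, iff_true]
    by_cases hz : pr z ∈ Up
    · exact Or.inl hz
    · right; apply hs; rw [← h.compl]; exact hz
  refine ⟨Up ∩ O', h.openUp.inter hO'o, ?_, unicoh h.oU (hO'o.preimage pr_cont) h.conU hc hu, ?_⟩
  · rintro a ⟨h1, h2⟩
    refine ⟨h1, ?_⟩
    rcases connectedComponentIn_subset _ _ h2 with h3 | h3
    · exact absurd h1 (Set.disjoint_left.1 h.disj h3)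
    · exact h3
  · intro x hx
    filter_upwards [hO'o.mem_nhds (hs (Or.inl hx))] with a ha hau using ⟨hau, ha⟩
end ctx


lemma log_homotopy {T α : Type*} [TopologicalSpace T] [PreconnectedSpace T] [TopologicalSpace α]
    [CompactSpace α] (u : T → α → ℂ) (hu : Continuous (fun p : T × α => u p.1 p.2))
    (h0 : ∀ t a, u t a ≠ 0) (t t' : T) (h : HasLog univ (u t)) : HasLog univ (u t') := by
  have key : ∀ t0 : T, ∀ᶠ t in 𝓝 t0, (HasLog univ (u t) ↔ HasLog univ (u t0)) := by
    intro t0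
    have h1 : ∀ᶠ t in 𝓝 t0, ∀ a ∈ (univ : Set α), ‖u t a - u t0 a‖ < ‖u t0 a‖ ∧ ‖u t0 a - u t a‖ < ‖u t a‖ := by
      apply isCompact_univ.eventually_forall_of_forall_eventually
      intro a _
      have hp : 0 < ‖u t0 a‖ := norm_pos_iff.2 (h0 _ _)
      have c1 : Continuous (fun z : T × α => u t0 z.2) := hu.comp (continuous_const.prodMk continuous_snd)
      have o1 : IsOpen {z : T × α | ‖u z.1 z.2 - u t0 z.2‖ < ‖u t0 z.2‖ ∧ ‖u t0 z.2 - u z.1 z.2‖ < ‖u z.1 z.2‖} :=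
        (isOpen_lt (hu.sub c1).norm c1.norm).inter (isOpen_lt (c1.sub hu).norm hu.norm)
      exact o1.mem_nhds (by simpa using h0 t0 a)
    have cu : ∀ s, Continuous (u s) := fun s => hu.comp (continuous_const.prodMk continuous_id)
    filter_upwards [h1] with s hs
    constructor
    · exact perturb (cu _).continuousOn (cu _).continuousOn (fun a ha => (hs a ha).2)
    · exact perturb (cu _).continuousOn (cu _).continuousOn (fun a ha => (hs a ha).1)
  have hcl : IsClopen {t | HasLog univ (u t)} := by
    constructor
    · rw [← isOpen_compl_iff, isOpen_iff_mem_nhds]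
      intro s hs
      filter_upwards [key s] with r hr hr' using hs (hr.1 hr')
    · rw [isOpen_iff_mem_nhds]
      intro s hs
      filter_upwards [key s] with r hr using hr.2 hs
  have := hcl.eq_univ ⟨t, h⟩
  have h2 : t' ∈ {t | HasLog univ (u t)} := this ▸ mem_univ t'
  exact h2

noncomputable def ee (p : Ann) : ℂ := ((2 + (p.2 : ℝ) : ℝ) : ℂ) * (AddCircle.toCircle p.1 : ℂ)

lemma ee_cont : Continuous ee := by
  unfold ee
  have : Continuous (fun p : Ann => (AddCircle.toCircle p.1 : ℂ)) :=
    continuous_subtype_val.comp (AddCircle.continuous_toCircle.comp continuous_fst)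
  fun_prop
lemma ee_norm (p : Ann) : ‖ee p‖ = 2 + p.2 := by
  unfold ee
  rw [norm_mul, Circle.norm_coe, mul_one, Complex.norm_real, Real.norm_eq_abs, abs_of_nonneg]
  have := p.2.2.1; linarith
lemma ee_inj : Injective ee := by
  intro p q h
  have h1 := congrArg norm h
  rw [ee_norm, ee_norm] at h1
  have h2 : (p.2 : ℝ) = q.2 := by linarith
  have h3 : ((2 + (q.2 : ℝ) : ℝ) : ℂ) ≠ 0 := by
    have := q.2.2.1
    norm_cast; linarith
  unfold ee at h
  rw [h2] at h
  have h4 := mul_left_cancel₀ h3 h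
  have h5 := AddCircle.injective_toCircle one_ne_zero (Circle.coe_injective h4)
  exact Prod.ext h5 (Subtype.ext h2)

lemma no_log_circle : ¬ HasLog univ (fun a : AddCircle (1:ℝ) => ee (a, tp) - ee (0, bt)) := by
  rintro ⟨g, hg, he⟩
  rw [continuousOn_univ] at hg
  have hval : ∀ x : ℝ, ee ((x : AddCircle (1:ℝ)), tp) - ee (0, bt) = 3 * Complex.exp (2 * Real.pi * Complex.I * x) - 1 := by
    intro x
    simp only [ee, AddCircle.toCircle_apply_mk, Circle.coe_exp]
    simp
    norm_num
    ring_nf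
  set c : ℝ → ℂ := fun x => 1 - Complex.exp (-(2 * Real.pi * Complex.I * x)) / 3 with hc
  have hcc : Continuous c := by fun_prop
  have hcs : ∀ x, c x ∈ Complex.slitPlane := by
    intro x
    have : c x = 1 + (- (Complex.exp (-(2 * Real.pi * Complex.I * x)) / 3)) := by simp [hc]; ring
    rw [this]
    apply Complex.mem_slitPlane_of_norm_lt_one
    rw [norm_neg, norm_div, Complex.norm_exp]
    simp
    norm_num
  have h1 := log_const (K := (univ : Set ℝ)) isPreconnected_univ (g := fun x : ℝ => g x)
    (h := fun x : ℝ => Complex.log 3 + 2 * Real.pi * Complex.I * x + Complex.log (c x))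
    (hg.comp (AddCircle.continuous_mk' 1)).continuousOn
    (((continuous_const.add (by fun_prop)).add (hcc.clog hcs)).continuousOn) (by
      intro x _
      have h3 : Complex.exp (Complex.log 3) = 3 := Complex.exp_log (by norm_num)
      show Complex.exp (g x) = Complex.exp _
      rw [he _ (mem_univ _)]
      beta_reduce
      rw [hval, Complex.exp_add, Complex.exp_add, Complex.exp_log (Complex.slitPlane_ne_zero (hcs x)), h3]
      simp only [hc, Complex.exp_neg]
      have := Complex.exp_ne_zero (2 * Real.pi * Complex.I * x)
      field_simp) (mem_univ 0) (mem_univ 1)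
  have hg1 : ((1:ℝ) : AddCircle (1:ℝ)) = ((0:ℝ) : AddCircle (1:ℝ)) := by
    rw [AddCircle.coe_period]; rfl
  have hc1 : c 1 = c 0 := by
    simp only [hc, Complex.exp_neg]
    simp [Complex.exp_two_pi_mul_I]
  simp only [hg1, hc1] at h1
  have : (2 * Real.pi * Complex.I : ℂ) = 0 := by
    push_cast at h1
    linear_combination h1
  simp at this

lemma f_Up {X Um Up : Set Ann} (h : IsEAC X Um Up) (f : Ann ≃ₜ Ann) (hf : IsotopicToId ⇑f)
    (hinv : ⇑f '' X = X) : ∀ a, f a ∈ Up ↔ a ∈ Up := by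
  obtain ⟨H, Hc, Hb, H0, H1⟩ := hf
  have nolog : ¬ HasLog univ (fun a : AddCircle (1:ℝ) => ee (f (a, tp)) - ee (f (0, bt))) := by
    intro hl
    have := log_homotopy (T := ℝ) (fun t (a : AddCircle (1:ℝ)) => ee (H t (a, tp)) - ee (H t (0, bt))) (by
      refine (ee_cont.comp (Hc.comp (continuous_fst.prodMk (continuous_snd.prodMk continuous_const)))).sub
        (ee_cont.comp (Hc.comp (continuous_fst.prodMk continuous_const))))
      (by
        intro t a h0
        have := (Hb t).1 (ee_inj (sub_eq_zero.1 h0))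
        have := congrArg (fun p : Ann => (p.2 : ℝ)) this
        norm_num at this) 1 0 (by rw [H1]; exact hl)
    rw [H0] at this
    exact no_log_circle this
  have hXm : ∀ a, f a ∈ X ↔ a ∈ X := by
    intro a
    constructor
    · intro ha
      rw [← hinv] at ha
      obtain ⟨b, hb, hba⟩ := ha
      rw [← f.injective hba]; exact hb
    · intro ha; rw [← hinv]; exact ⟨a, ha, rfl⟩
  have dich : ∀ S : Set Ann, IsPreconnected S → S ⊆ Xᶜ → (f '' S ⊆ Um ∨ f '' S ⊆ Up) := by
    intro S hS hSX
    have hp := hS.image f f.continuous.continuousOn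
    have hsub : f '' S ⊆ Um ∪ Up := by
      rw [← h.cover]
      rintro _ ⟨a, ha, rfl⟩ hx
      exact hSX ha ((hXm a).1 hx)
    rcases (f '' S).eq_empty_or_nonempty with he | hne
    · left; rw [he]; exact empty_subset _
    by_contra hcon
    push Not at hcon
    obtain ⟨p, hp1, hp2⟩ := not_subset.1 hcon.1
    obtain ⟨q, hq1, hq2⟩ := not_subset.1 hcon.2
    obtain ⟨y, _, hy1, hy2⟩ := hp _ _ h.openUm h.openUp hsub ⟨q, hq1, (hsub hq1).resolve_right hq2⟩
      ⟨p, hp1, (hsub hp1).resolve_left hp2⟩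
    exact Set.disjoint_left.1 h.disj hy1 hy2
  have cov : ∀ b, b ∈ Um ∪ Up → ∃ a, (a ∈ Um ∨ a ∈ Up) ∧ f a = b := by
    intro b hb
    obtain ⟨a, rfl⟩ := f.surjective b
    refine ⟨a, ?_, rfl⟩
    have : a ∈ Um ∪ Up := by
      rw [← h.cover] at hb ⊢
      exact fun hx => hb ((hXm a).2 hx)
    exact this
  have dUp := dich Up h.conUp (by rw [h.cover]; exact subset_union_right)
  have dUm := dich Um h.conUm (by rw [h.cover]; exact subset_union_left)
  have dj : ∀ a, a ∈ Um → a ∉ Up := fun a h1 h2 => Set.disjoint_left.1 h.disj h1 h2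
  have main : f '' Up ⊆ Up ∧ f '' Um ⊆ Um := by
    rcases dUp with h1 | h1 <;> rcases dUm with h2 | h2
    · exfalso
      obtain ⟨a, ha, hb⟩ := cov _ (Or.inr (h.circ_top 0))
      rcases ha with ha | ha
      · exact dj _ (h2 ⟨a, ha, rfl⟩) (hb ▸ h.circ_top 0)
      · exact dj _ (h1 ⟨a, ha, rfl⟩) (hb ▸ h.circ_top 0)
    · exfalso
      have : PreconnectedSpace Up := Subtype.preconnectedSpace h.conUp
      apply nolog
      have hfm : ∀ a, f (a, tp) ∈ Um := fun a => h1 ⟨_, h.circ_top a, rfl⟩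
      refine log_homotopy (T := Up) (fun p (a : AddCircle (1:ℝ)) => ee (f (a, tp)) - ee p) (by
        refine (ee_cont.comp (f.continuous.comp (continuous_snd.prodMk continuous_const))).sub
          (ee_cont.comp (continuous_subtype_val.comp continuous_fst))) ?_ ⟨(0, tp), h.circ_top 0⟩
          ⟨f (0, bt), h2 ⟨_, h.circ_bot 0, rfl⟩⟩ ?_
      · intro p a h0
        have := ee_inj (sub_eq_zero.1 h0)
        exact dj _ (hfm a) (this ▸ p.2)
      · refine HasLog.of_slit (-1) (by norm_num) ?_ ?_
        · exact ((ee_cont.comp (f.continuous.comp (continuous_id.prodMk continuous_const))).sub continuous_const).continuousOn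
        · intro a _
          left
          have e3 : ee (0, tp) = 3 := by simp [ee]; norm_num
          simp only [e3]
          have hle : ‖ee (f (a, tp))‖ ≤ 3 := by rw [ee_norm]; have := (f (a,tp)).2.2.2; linarith
          have hne : ee (f (a, tp)) ≠ 3 := by
            rw [← e3]; intro h0
            exact dj _ (hfm a) ((ee_inj h0) ▸ h.circ_top 0)
          have hre : (ee (f (a, tp))).re < 3 := by
            rcases lt_or_eq_of_le ((Complex.re_le_norm _).trans hle) with hlt | heq
            · exact hlt
            · exfalso; apply hne
              have h5 : (ee (f (a, tp))).im = 0 := by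
                have := Complex.sq_norm_sub_sq_re (ee (f (a, tp)))
                have hn := norm_nonneg (ee (f (a, tp)))
                rw [heq] at this
                nlinarith
              apply Complex.ext
              · simpa using heq
              · simpa using h5
          simp; linarith
    · exact ⟨h1, h2⟩
    · exfalso
      obtain ⟨a, ha, hb⟩ := cov _ (Or.inl (h.circ_bot 0))
      rcases ha with ha | ha
      · exact dj _ (h.circ_bot 0) (hb ▸ h2 ⟨a, ha, rfl⟩)
      · exact dj _ (h.circ_bot 0) (hb ▸ h1 ⟨a, ha, rfl⟩)
  intro a
  constructor
  · intro ha
    have hx : a ∈ Xᶜ := fun hx => h.notX_of_Up ha ((hXm a).2 hx)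
    rw [h.cover] at hx
    rcases hx with hx | hx
    · exact absurd ha (dj _ (main.2 ⟨a, hx, rfl⟩))
    · exact hx
  · intro ha; exact main.1 ⟨a, ha, rfl⟩


structure Cx (X Um Up : Set Ann) (η : II) : Prop where
  eac : IsEAC X Um Up
  mem : pr ((0:ℝ), η) ∈ X
  gt : ∀ y : II, η < y → pr ((0:ℝ), y) ∉ X

def bet (η : II) (S : Set ℤ) : Set Strip := {z | (∃ k ∈ S, z.1 = (k:ℝ)) ∧ η < z.2}
def xk (η : II) (k : ℤ) : Strip := ((k:ℝ), η)
/-- components of the complement of vertical lines -/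
def Cmp (Up : Set Ann) (η : II) (S : Set ℤ) (x : ℝ) : Set Strip :=
  connectedComponentIn (pr ⁻¹' Up \ bet η S) (x, tp)
def LL (Up : Set Ann) (η : II) (k : ℤ) : Set Strip := Cmp Up η {k} ((k:ℝ) - 1/2)
def RR (Up : Set Ann) (η : II) (k : ℤ) : Set Strip := Cmp Up η {k} ((k:ℝ) + 1/2)

lemma exists_eta {X Um Up : Set Ann} (h : IsEAC X Um Up) : ∃ η : II, Cx X Um Up η := by
  set S : Set II := {y | pr ((0:ℝ), y) ∈ X} with hS
  have hc : IsCompact S := (h.compact.isClosed.preimage (pr_cont.comp (continuous_const.prodMk continuous_id))).isCompact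
  have hne : S.Nonempty := by
    by_contra hcon
    rw [not_nonempty_iff_eq_empty] at hcon
    have hp := (rect_preconn {0} univ ordConnected_singleton ordConnected_univ).image pr pr_cont.continuousOn
    have hsub : pr '' {z : Strip | z.1 ∈ ({0} : Set ℝ) ∧ (z.2:ℝ) ∈ (univ : Set ℝ)} ⊆ Um ∪ Up := by
      rw [← h.cover]
      rintro _ ⟨⟨x, y⟩, ⟨hx, -⟩, rfl⟩ hX
      simp only [mem_singleton_iff] at hx
      subst hx
      have : y ∈ S := hX
      rw [hcon] at this; exact this
    obtain ⟨y, _, h1, h2⟩ := hp _ _ h.openUm h.openUp hsub ⟨_, ⟨((0:ℝ), bt), by simp, rfl⟩, h.circ_bot _⟩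
      ⟨_, ⟨((0:ℝ), tp), by simp, rfl⟩, h.circ_top _⟩
    exact Set.disjoint_left.1 h.disj h1 h2
  obtain ⟨η, hη⟩ := hc.exists_isGreatest hne
  exact ⟨η, h, hη.1, fun y hy hyX => absurd (hη.2 hyX) (not_le.2 hy)⟩

lemma int_pr (k : ℤ) (y : II) : pr ((k:ℝ), y) = pr ((0:ℝ), y) := by
  have := pr_shift k ((0:ℝ), y)
  simpa [shiftPt] using this

lemma dist_lt_iff (p z : Strip) (r : ℝ) : dist z p < r ↔ |z.1 - p.1| < r ∧ |(z.2:ℝ) - p.2| < r := by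
  rw [Prod.dist_eq, max_lt_iff, Real.dist_eq, Subtype.dist_eq, Real.dist_eq]

namespace Cx
variable {X Um Up : Set Ann} {η : II} (c : Cx X Um Up η)
include c

lemma xk_mem (k : ℤ) : pr (xk η k) ∈ X := by
  unfold xk; rw [int_pr]; exact c.mem
lemma xk_notU (k : ℤ) : xk η k ∉ pr ⁻¹' Up := fun h => c.eac.notX_of_Up h (c.xk_mem k)
lemma vert_U {k : ℤ} {y : II} (hy : η < y) : ((k:ℝ), y) ∈ pr ⁻¹' Up := by
  have hp := (rect_preconn {(k:ℝ)} (Ici (y:ℝ)) ordConnected_singleton ordConnected_Ici).image pr pr_cont.continuousOn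
  have hsub : pr '' {z : Strip | z.1 ∈ ({(k:ℝ)} : Set ℝ) ∧ (z.2:ℝ) ∈ Ici (y:ℝ)} ⊆ Xᶜ := by
    rintro _ ⟨⟨x, w⟩, ⟨hx, hw⟩, rfl⟩ hX
    simp only [mem_singleton_iff] at hx
    subst hx
    rw [int_pr] at hX
    have h2 : (y:ℝ) ≤ w := hw
    have : η < w := lt_of_lt_of_le hy h2
    exact c.gt w this hX
  have ht : pr ((k:ℝ), tp) ∈ Up := c.eac.circ_top _
  rw [mem_preimage, c.eac.hUp]
  rw [c.eac.hUp] at ht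
  rw [connectedComponentIn_eq ht]
  refine hp.subset_connectedComponentIn ⟨((k:ℝ), tp), ?_, rfl⟩ hsub ⟨((k:ℝ), y), ?_, rfl⟩
  · exact ⟨rfl, y.2.2⟩
  · simp
lemma bet_U (S : Set ℤ) : bet η S ⊆ pr ⁻¹' Up := by
  rintro ⟨x, y⟩ ⟨⟨k, -, hk⟩, hy⟩
  simp only at hk hy
  subst hk
  exact c.vert_U hy
lemma eta_lt : η < tp := by
  have := (c.eac.inInterior _ c.mem).2
  exact this
omit c in
lemma bet_closed (S : Set ℤ) : IsClosed {z : Strip | (∃ k ∈ S, z.1 = (k:ℝ)) ∧ η ≤ z.2} := by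
  have h1 : IsClosed ((fun k : ℤ => (k:ℝ)) '' S) := Int.isClosedEmbedding_coe_real.isClosedMap _ (isClosed_discrete S)
  have h2 : IsClosed {z : Strip | η ≤ z.2} := isClosed_le continuous_const continuous_snd
  have h3 := (h1.preimage (continuous_fst (X := ℝ) (Y := II))).inter h2
  convert h3 using 1
  ext z
  simp only [mem_ofPred_eq, mem_inter_iff, mem_preimage, mem_image]
  constructor
  · rintro ⟨⟨k, hk, e⟩, h⟩; exact ⟨⟨k, hk, e.symm⟩, h⟩
  · rintro ⟨⟨k, hk, e⟩, h⟩; exact ⟨⟨k, hk, e.symm⟩, h⟩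
lemma diff_eq (S : Set ℤ) : pr ⁻¹' Up \ bet η S = pr ⁻¹' Up \ {z : Strip | (∃ k ∈ S, z.1 = (k:ℝ)) ∧ η ≤ z.2} := by
  ext z
  simp only [Set.mem_sdiff, bet, mem_ofPred_eq]
  constructor
  · rintro ⟨hU, h⟩
    refine ⟨hU, ?_⟩
    rintro ⟨⟨k, hk, e⟩, h2⟩
    rcases h2.lt_or_eq with h3 | h3
    · exact h ⟨⟨k, hk, e⟩, h3⟩
    · apply c.xk_notU k
      have : xk η k = z := Prod.ext e.symm h3
      rw [this]; exact hU
  · rintro ⟨hU, h⟩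
    exact ⟨hU, fun h2 => h ⟨h2.1, h2.2.le⟩⟩
lemma diff_open (S : Set ℤ) : IsOpen (pr ⁻¹' Up \ bet η S) := by
  rw [c.diff_eq]
  exact c.eac.oU.sdiff (bet_closed S)

/-- near the vertical line -/
lemma thin {k : ℤ} {b : II} (hb : η < b) : ∃ ε : ℝ, 0 < ε ∧ ε < 1 ∧
    ∀ z : Strip, |z.1 - k| < ε → (b:ℝ) - ε < z.2 → z ∈ pr ⁻¹' Up ∧ η < z.2 := by
  have hK : IsCompact ((fun y : II => ((k:ℝ), y)) '' Ici b) :=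
    (isClosed_Ici.isCompact).image (by fun_prop)
  have hKU : (fun y : II => ((k:ℝ), y)) '' Ici b ⊆ pr ⁻¹' Up := by
    rintro _ ⟨y, hy, rfl⟩
    exact c.vert_U (lt_of_lt_of_le hb hy)
  obtain ⟨δ, hδ, hs⟩ := hK.exists_thickening_subset_open c.eac.oU hKU
  have hb' : (η:ℝ) < b := hb
  refine ⟨min (δ) (min (1/2) ((b:ℝ) - η)), lt_min hδ (lt_min (by norm_num) (by linarith)), ?_, ?_⟩
  · exact lt_of_le_of_lt (min_le_right _ _) (lt_of_le_of_lt (min_le_left _ _) (by norm_num))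
  · intro z h1 h2
    have e1 : min (δ) (min (1/2) ((b:ℝ) - η)) ≤ δ := min_le_left _ _
    have e2 : min (δ) (min (1/2) ((b:ℝ) - η)) ≤ (b:ℝ) - η := (min_le_right _ _).trans (min_le_right _ _)
    constructor
    · apply hs
      rw [Metric.mem_thickening_iff]
      refine ⟨((k:ℝ), max b z.2), ⟨_, mem_Ici.2 (le_max_left _ _), rfl⟩, ?_⟩
      rw [dist_lt_iff]
      refine ⟨by simp only; linarith, ?_⟩
      rcases le_total b z.2 with h3 | h3
      · rw [max_eq_right h3]; simpa using hδ
      · rw [max_eq_left h3]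
        have h3' : (z.2:ℝ) ≤ b := h3
        rw [abs_lt]; constructor <;> linarith
    · show (η:ℝ) < z.2
      linarith
end Cx


namespace Cx
variable {X Um Up : Set Ann} {η : II} (c : Cx X Um Up η)
include c

lemma top_diff {S : Set ℤ} {x : ℝ} (hx : ∀ k ∈ S, x ≠ k) : (x, tp) ∈ pr ⁻¹' Up \ bet η S :=
  ⟨c.eac.topU rfl, fun h => by obtain ⟨⟨k, hk, e⟩, -⟩ := h; exact hx k hk e⟩

lemma climb (S : Set ℤ) (hS : S.Nonempty) {z : Strip} (hz : z ∈ pr ⁻¹' Up \ bet η S) :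
    ∃ x : ℝ, (∃ k ∈ S, 0 < |x - k| ∧ |x - k| < 1) ∧ (x, tp) ∈ connectedComponentIn (pr ⁻¹' Up \ bet η S) z := by
  set W := pr ⁻¹' Up \ bet η S with hW
  set D := connectedComponentIn W z with hD
  have hDo : IsOpen D := (c.diff_open S).connectedComponentIn
  have hDW : D ⊆ W := connectedComponentIn_subset _ _
  have hbd : ∃ b ∈ bet η S, b ∈ closure D := by
    by_contra hcon
    push Not at hcon
    have hsub : pr ⁻¹' Up ⊆ D ∪ (closure D)ᶜ := by
      intro w hw
      by_cases hwc : w ∈ closure D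
      · left
        have hwW : w ∈ W := ⟨hw, fun h => hcon w h hwc⟩
        obtain ⟨v, hv1, hv2⟩ := mem_closure_iff.1 hwc _ ((c.diff_open S).connectedComponentIn (x := w)) (mem_connectedComponentIn hwW)
        rw [hD, connectedComponentIn_eq hv2, ← connectedComponentIn_eq hv1]
        exact mem_connectedComponentIn hwW
      · exact Or.inr hwc
    obtain ⟨k, hk⟩ := hS
    have hb : ((k:ℝ), tp) ∈ bet η S := ⟨⟨k, hk, rfl⟩, c.eta_lt⟩
    obtain ⟨v, _, hv1, hv2⟩ := c.eac.conU _ _ hDo isClosed_closure.isOpen_compl hsub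
      ⟨z, hz.1, mem_connectedComponentIn hz⟩ ⟨((k:ℝ), tp), c.bet_U S hb, hcon _ hb⟩
    exact hv2 (subset_closure hv1)
  obtain ⟨⟨b1, b⟩, ⟨⟨k, hk, e⟩, hb⟩, hbc⟩ := hbd
  simp only at e hb
  subst e
  obtain ⟨ε, hε, hε1, hthin⟩ := c.thin (k := k) hb
  obtain ⟨w, hwD, hwd⟩ := Metric.mem_closure_iff.1 hbc ε hε
  rw [dist_comm, dist_lt_iff] at hwd
  obtain ⟨hw1, hw2⟩ := hwd
  simp only at hw1 hw2
  have hwb : (b:ℝ) - ε < w.2 := by linarith [(abs_lt.1 hw2).1]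
  have hwk : w.1 ≠ k := by
    intro he
    exact (hDW hwD).2 ⟨⟨k, hk, he⟩, (hthin w hw1 hwb).2⟩
  have hnear : ∀ v : Strip, v.1 ≠ k → |v.1 - k| < ε → (b:ℝ) - ε < v.2 → v ∈ W := by
    intro v h1 h2 h3
    refine ⟨(hthin v h2 h3).1, ?_⟩
    rintro ⟨⟨m, hm, e⟩, -⟩
    rw [e] at h2 h1
    have h4 : |((m - k : ℤ) : ℝ)| < 1 := by push_cast; linarith
    have h5 : |m - k| < 1 := by exact_mod_cast h4
    have h6 : m = k := by have := Int.abs_lt_one_iff.1 h5; omega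
    exact h1 (by rw [h6])
  have hbt : (b:ℝ) - ε < 1 := by have := b.2.2; linarith
  refine ⟨w.1, ⟨k, hk, abs_pos.2 (sub_ne_zero.2 hwk), hw1.trans hε1⟩, ?_⟩
  rw [hD, connectedComponentIn_eq hwD]
  rcases lt_or_gt_of_ne hwk with hlt | hlt
  · have hp := rect_preconn (Ioo ((k:ℝ) - ε) k) (Ioi ((b:ℝ) - ε)) ordConnected_Ioo ordConnected_Ioi
    refine hp.subset_connectedComponentIn ⟨⟨by linarith [(abs_lt.1 hw1).1], hlt⟩, hwb⟩ ?_ ⟨⟨by linarith [(abs_lt.1 hw1).1], hlt⟩, hbt⟩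
    rintro v ⟨⟨h1, h2⟩, h3⟩
    exact hnear v h2.ne (by rw [abs_lt]; constructor <;> linarith) h3
  · have hp := rect_preconn (Ioo (k:ℝ) (k + ε)) (Ioi ((b:ℝ) - ε)) ordConnected_Ioo ordConnected_Ioi
    refine hp.subset_connectedComponentIn ⟨⟨hlt, by linarith [(abs_lt.1 hw1).2]⟩, hwb⟩ ?_ ⟨⟨hlt, by linarith [(abs_lt.1 hw1).2]⟩, hbt⟩
    rintro v ⟨⟨h1, h2⟩, h3⟩
    exact hnear v h1.ne' (by rw [abs_lt]; constructor <;> linarith) h3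

lemma cmp_eq {S : Set ℤ} {I : Set ℝ} (hI : I.OrdConnected) (h : ∀ x ∈ I, ∀ k ∈ S, x ≠ k) {x y : ℝ} (hx : x ∈ I) (hy : y ∈ I) :
    (y, tp) ∈ Cmp Up η S x := by
  have hp := rect_preconn I {1} hI ordConnected_singleton
  refine hp.subset_connectedComponentIn (x := (x, tp)) ⟨hx, show (tp:ℝ) ∈ ({1}:Set ℝ) from rfl⟩ ?_ ⟨hy, show (tp:ℝ) ∈ ({1}:Set ℝ) from rfl⟩
  rintro ⟨v, w⟩ ⟨h1, h2⟩
  have : w = tp := Subtype.ext h2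
  rw [this]
  exact c.top_diff (h v h1)

lemma LL_open (k : ℤ) : IsOpen (LL Up η k) := (c.diff_open _).connectedComponentIn
lemma RR_open (k : ℤ) : IsOpen (RR Up η k) := (c.diff_open _).connectedComponentIn
omit c in
lemma LL_pre (k : ℤ) : IsPreconnected (LL Up η k) := isPreconnected_connectedComponentIn
omit c in
lemma RR_pre (k : ℤ) : IsPreconnected (RR Up η k) := isPreconnected_connectedComponentIn
omit c in
lemma LL_sub (k : ℤ) : LL Up η k ⊆ pr ⁻¹' Up \ bet η {k} := connectedComponentIn_subset _ _
omit c in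
lemma RR_sub (k : ℤ) : RR Up η k ⊆ pr ⁻¹' Up \ bet η {k} := connectedComponentIn_subset _ _
lemma LL_top {k : ℤ} {x : ℝ} (h : x < k) : (x, tp) ∈ LL Up η k :=
  c.cmp_eq (I := Iio (k:ℝ)) ordConnected_Iio (by rintro x hx m rfl; exact hx.ne) (by simp) h
lemma RR_top {k : ℤ} {x : ℝ} (h : k < x) : (x, tp) ∈ RR Up η k :=
  c.cmp_eq (I := Ioi (k:ℝ)) ordConnected_Ioi (by rintro x hx m rfl; exact (mem_Ioi.1 hx).ne') (by simp) h
omit c in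
lemma sub_LL {k : ℤ} {P : Set Strip} (hP : IsPreconnected P) (hs : P ⊆ pr ⁻¹' Up \ bet η {k}) {z : Strip} (hz : z ∈ P)
    (hzL : z ∈ LL Up η k) : P ⊆ LL Up η k := by
  unfold LL Cmp at hzL ⊢
  rw [connectedComponentIn_eq hzL]
  exact hP.subset_connectedComponentIn hz hs
omit c in
lemma sub_RR {k : ℤ} {P : Set Strip} (hP : IsPreconnected P) (hs : P ⊆ pr ⁻¹' Up \ bet η {k}) {z : Strip} (hz : z ∈ P)
    (hzL : z ∈ RR Up η k) : P ⊆ RR Up η k := by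
  unfold RR Cmp at hzL ⊢
  rw [connectedComponentIn_eq hzL]
  exact hP.subset_connectedComponentIn hz hs
lemma LR_cover {k : ℤ} {z : Strip} (hz : z ∈ pr ⁻¹' Up \ bet η {k}) : z ∈ LL Up η k ∨ z ∈ RR Up η k := by
  obtain ⟨x, ⟨m, hm, hx, -⟩, hc⟩ := c.climb {k} ⟨k, rfl⟩ hz
  simp only [mem_singleton_iff] at hm
  subst hm
  have hp : IsPreconnected (connectedComponentIn (pr ⁻¹' Up \ bet η {m}) z) := isPreconnected_connectedComponentIn
  rcases lt_or_gt_of_ne (sub_ne_zero.1 (abs_pos.1 hx)) with h | h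
  · left; exact sub_LL hp (connectedComponentIn_subset _ _) hc (c.LL_top h) (mem_connectedComponentIn hz)
  · right; exact sub_RR hp (connectedComponentIn_subset _ _) hc (c.RR_top h) (mem_connectedComponentIn hz)
end Cx

lemma cx_norm_le (z w : Strip) : ‖cx z - cx w‖ ≤ 2 * dist z w := by
  have h1 := Complex.norm_le_abs_re_add_abs_im (cx z - cx w)
  have h2 : |z.1 - w.1| ≤ dist z w := by rw [Prod.dist_eq, ← Real.dist_eq]; exact le_max_left _ _
  have h3 : |(z.2:ℝ) - w.2| ≤ dist z w := by
    rw [Prod.dist_eq, ← Real.dist_eq, ← Subtype.dist_eq]; exact le_max_right _ _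
  simp at h1
  linarith

lemma dist_shift (k : ℤ) (z w : Strip) : dist (shiftPt k z) (shiftPt k w) = dist z w := by
  simp [shiftPt, Prod.dist_eq]

lemma IsEAC.compact_log {X Um Up : Set Ann} (h : IsEAC X Um Up) {K : Set Strip} (hK : IsCompact K) (hKU : K ⊆ pr ⁻¹' Up)
    {e : Strip} (he : e ∉ pr ⁻¹' Up) : HasLog K (fun z => cx z - cx e) := by
  obtain ⟨r, hr, hs⟩ := hK.exists_thickening_subset_open h.oU hKU
  have hfar : ∀ z ∈ K, ∀ e ∉ pr ⁻¹' Up, r ≤ dist z e := by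
    intro z hz e he
    by_contra hlt
    push Not at hlt
    apply he; apply hs
    rw [Metric.mem_thickening_iff]
    exact ⟨z, hz, by rwa [dist_comm]⟩
  have hcl : ∀ e ∉ pr ⁻¹' Up, ∀ e', e' ∉ pr ⁻¹' Up → dist e e' < r / 2 → HasLog K (fun z => cx z - cx e) →
      HasLog K (fun z => cx z - cx e') := by
    intro e he e' he' hd
    apply perturb (cx_cont.sub continuous_const).continuousOn (cx_cont.sub continuous_const).continuousOn
    intro z hz
    have h1 : ‖cx z - cx e' - (cx z - cx e)‖ = ‖cx e - cx e'‖ := by congr 1; ring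
    show ‖cx z - cx e' - (cx z - cx e)‖ < ‖cx z - cx e‖
    rw [h1]
    have := hfar z hz e he
    linarith [cx_norm_le e e', cx_norm_ge z e]
  have hpc : PreconnectedSpace (Upᶜ : Set Ann) := Subtype.preconnectedSpace (by rw [h.compl]; exact h.conXUm)
  set S : Set (Upᶜ : Set Ann) := {p | ∀ e, pr e = p → HasLog K (fun z => cx z - cx e)} with hS
  have nb : ∀ e0 : Strip, pr '' (Metric.ball e0 (r/2)) ∈ 𝓝 (pr e0) := fun e0 =>
    pr_open.image_mem_nhds (Metric.ball_mem_nhds _ (by linarith))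
  have hclop : IsClopen S := by
    constructor
    · rw [← isOpen_compl_iff, isOpen_iff_mem_nhds]
      rintro p hp
      simp only [hS, mem_compl_iff, mem_ofPred_eq, not_forall] at hp
      obtain ⟨e0, he0, hbad⟩ := hp
      have := nb e0
      rw [he0] at this
      filter_upwards [continuous_subtype_val.continuousAt.preimage_mem_nhds this] with q hq hqS
      obtain ⟨e1, he1, he1q⟩ := hq
      rw [Metric.mem_ball] at he1
      apply hbad
      refine hcl e1 (fun hU => q.2 (he1q ▸ hU)) e0 (fun hU => p.2 (he0 ▸ hU)) he1 (hqS e1 he1q)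
    · rw [isOpen_iff_mem_nhds]
      intro p hp
      obtain ⟨e0, he0⟩ := pr_surj (p : Ann)
      have := nb e0
      rw [he0] at this
      filter_upwards [continuous_subtype_val.continuousAt.preimage_mem_nhds this] with q hq
      intro e heq
      obtain ⟨e1, he1, he1q⟩ := hq
      obtain ⟨k, rfl⟩ := pr_eq (he1q.trans heq.symm)
      have hpk : pr (shiftPt k e0) = p := by rw [pr_shift, he0]
      refine hcl (shiftPt k e0) (fun hU => p.2 (hpk ▸ hU)) _ (fun hU => q.2 (heq ▸ hU)) ?_ (hp _ hpk)
      rw [dist_shift, dist_comm]; exact he1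
  have hne : S.Nonempty := by
    refine ⟨⟨((0 : AddCircle (1:ℝ)), bt), fun hU => Set.disjoint_left.1 h.disj (h.circ_bot 0) hU⟩, ?_⟩
    intro e hee
    have he2 : (e.2:ℝ) = -1 := by
      have := congrArg (fun p : Ann => (p.2:ℝ)) hee
      simpa [pr] using this
    refine HasLog.of_slit (-Complex.I) (by simp) (cx_cont.sub continuous_const).continuousOn ?_
    intro z hz
    have hze : z ≠ e := by
      rintro rfl
      have h1 := hKU hz
      rw [mem_preimage, hee] at h1
      exact Set.disjoint_left.1 h.disj (h.circ_bot 0) h1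
    rw [Complex.mem_slitPlane_iff]
    simp only [neg_mul, Complex.neg_re, Complex.mul_re, Complex.I_re, Complex.I_im, Complex.sub_re, Complex.sub_im, cx_re, cx_im,
      Complex.neg_im, Complex.mul_im, he2]
    have hz2 := z.2.2.1
    rcases hz2.lt_or_eq with h1 | h1
    · left; linarith
    · right
      intro h0
      apply hze
      refine Prod.ext ?_ (Subtype.ext ?_)
      · linarith
      · rw [he2, h1]
  have huniv := hclop.eq_univ hne
  have : (⟨pr e, he⟩ : (Upᶜ : Set Ann)) ∈ S := huniv ▸ mem_univ _
  exact this e rfl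


/-- compact connected sets joining two points of an open preconnected set -/
lemma join_compact {W : Set Strip} (hW : IsOpen W) (cW : IsPreconnected W) {p q : Strip} (hp : p ∈ W) (hq : q ∈ W) :
    ∃ K : Set Strip, IsCompact K ∧ IsPreconnected K ∧ K ⊆ W ∧ p ∈ K ∧ q ∈ K := by
  have : IsPathConnected W := hW.isConnected_iff_isPathConnected.1 ⟨⟨p, hp⟩, cW⟩
  obtain ⟨γ, hγ⟩ := this.joinedIn p hp q hq
  refine ⟨range γ, isCompact_range γ.continuous, isPreconnected_range γ.continuous, ?_, ⟨0, γ.source⟩, ⟨1, γ.target⟩⟩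
  rintro _ ⟨t, rfl⟩; exact hγ t

namespace Cx
variable {X Um Up : Set Ann} {η : II} (c : Cx X Um Up η)
include c

lemma LR_disj (k : ℤ) : Disjoint (LL Up η k) (RR Up η k) := by
  rw [Set.disjoint_left]
  intro z0 hz0L hz0R
  have hR : RR Up η k ⊆ LL Up η k := sub_LL (RR_pre k) (RR_sub k) hz0R hz0L
  set p : Strip := ((k:ℝ) - 1/2, tp) with hp
  set q : Strip := ((k:ℝ) + 1/2, tp) with hq
  have hpL : p ∈ LL Up η k := c.LL_top (by linarith)
  have hqL : q ∈ LL Up η k := hR (c.RR_top (by linarith))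
  obtain ⟨K, hK, cK, hKW, hpK, hqK⟩ := join_compact (c.LL_open k) (LL_pre k) hpL hqL
  set S : Set Strip := (fun x : ℝ => (x, tp)) '' Icc ((k:ℝ) - 1/2) (k + 1/2) with hS
  have hSc : IsCompact S := isCompact_Icc.image (by fun_prop)
  have hSp : IsPreconnected S := isPreconnected_Icc.image _ (by fun_prop)
  have hpS : p ∈ S := ⟨_, ⟨le_rfl, by linarith⟩, rfl⟩
  have hqS : q ∈ S := ⟨_, ⟨by linarith, le_rfl⟩, rfl⟩
  obtain ⟨g, hg, he⟩ := c.eac.compact_log (hK.union hSc) (by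
    rintro z (hz | ⟨x, -, rfl⟩)
    · exact (LL_sub k (hKW hz)).1
    · exact c.eac.topU rfl) (c.xk_notU k)
  have hη := c.eta_lt
  have hη' : (η:ℝ) < 1 := hη
  have cu : ContinuousOn (fun z => cx z - cx (xk η k)) (K ∪ S) := (cx_cont.sub continuous_const).continuousOn
  have sl1 : ∀ z ∈ K, Complex.I * (cx z - cx (xk η k)) ∈ Complex.slitPlane := by
    intro z hz
    have h1 := LL_sub k (hKW hz)
    rw [Complex.mem_slitPlane_iff]
    simp only [Complex.mul_re, Complex.I_re, Complex.I_im, Complex.sub_re, Complex.sub_im, cx_re, cx_im, Complex.mul_im, xk]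
    by_contra hcon
    push Not at hcon
    obtain ⟨h2, h3⟩ := hcon
    have h4 : z.1 = k := by linarith
    have h5 : (η:ℝ) ≤ z.2 := by linarith
    rw [c.diff_eq] at h1
    exact h1.2 ⟨⟨k, rfl, h4⟩, h5⟩
  have sl2 : ∀ z ∈ S, (-Complex.I) * (cx z - cx (xk η k)) ∈ Complex.slitPlane := by
    rintro _ ⟨x, -, rfl⟩
    left
    simp [xk]
    linarith
  have e1 := log_const cK (g := g) (h := fun z => Complex.log (Complex.I * (cx z - cx (xk η k))) - Complex.log Complex.I)
    (hg.mono subset_union_left) (((continuousOn_const.mul (cu.mono subset_union_left)).clog sl1).sub continuousOn_const)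
    (by
      intro z hz
      rw [he z (Or.inl hz), Complex.exp_sub, Complex.exp_log (Complex.slitPlane_ne_zero (sl1 z hz)), Complex.exp_log (by simp)]
      field_simp) hpK hqK
  have e2 := log_const hSp (g := g) (h := fun z => Complex.log ((-Complex.I) * (cx z - cx (xk η k))) - Complex.log (-Complex.I))
    (hg.mono subset_union_right) (((continuousOn_const.mul (cu.mono subset_union_right)).clog sl2).sub continuousOn_const)
    (by
      intro z hz
      rw [he z (Or.inr hz), Complex.exp_sub, Complex.exp_log (Complex.slitPlane_ne_zero (sl2 z hz)), Complex.exp_log (by simp)]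
      field_simp) hpS hqS
  have e3 : Complex.log (Complex.I * (cx p - cx (xk η k))) - Complex.log (Complex.I * (cx q - cx (xk η k)))
      = Complex.log ((-Complex.I) * (cx p - cx (xk η k))) - Complex.log ((-Complex.I) * (cx q - cx (xk η k))) := by
    linear_combination e2 - e1
  have e4 := congrArg Complex.im e3
  simp only [Complex.sub_im, Complex.log_im] at e4
  have a1 : (Complex.I * (cx p - cx (xk η k))).arg < 0 := by
    rw [Complex.arg_neg_iff]; simp [hp, xk]
  have a2 : 0 ≤ (Complex.I * (cx q - cx (xk η k))).arg := by
    rw [Complex.arg_nonneg_iff]; simp [hq, xk]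
  have a3 : 0 ≤ ((-Complex.I) * (cx p - cx (xk η k))).arg := by
    rw [Complex.arg_nonneg_iff]; simp [hp, xk]
  have a4 : ((-Complex.I) * (cx q - cx (xk η k))).arg < 0 := by
    rw [Complex.arg_neg_iff]; simp [hq, xk]
  linarith

omit c in
lemma bet_pre (k : ℤ) : IsPreconnected (bet η {k}) := by
  have := rect_preconn {(k:ℝ)} (Ioi (η:ℝ)) ordConnected_singleton ordConnected_Ioi
  convert this using 1
  ext z
  simp [bet]
lemma bet_LL {k m : ℤ} (h : k < m) : bet η {k} ⊆ LL Up η m := by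
  have hkm : (k:ℝ) < m := by exact_mod_cast h
  refine sub_LL (bet_pre k) (fun z hz => ⟨c.bet_U _ hz, ?_⟩) (z := ((k:ℝ), tp)) ⟨⟨k, rfl, rfl⟩, c.eta_lt⟩ (c.LL_top hkm)
  rintro ⟨⟨_, rfl, e⟩, -⟩
  obtain ⟨⟨_, rfl, e'⟩, -⟩ := hz
  rw [e] at e'; linarith
lemma bet_RR {k m : ℤ} (h : k < m) : bet η {m} ⊆ RR Up η k := by
  have hkm : (k:ℝ) < m := by exact_mod_cast h
  refine sub_RR (bet_pre m) (fun z hz => ⟨c.bet_U _ hz, ?_⟩) (z := ((m:ℝ), tp)) ⟨⟨m, rfl, rfl⟩, c.eta_lt⟩ (c.RR_top hkm)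
  rintro ⟨⟨_, rfl, e⟩, -⟩
  obtain ⟨⟨_, rfl, e'⟩, -⟩ := hz
  rw [e] at e'; linarith
lemma RR_mono {k m : ℤ} (h : k ≤ m) : RR Up η m ⊆ RR Up η k := by
  rcases h.eq_or_lt with rfl | h
  · exact subset_rfl
  have hkm : (k:ℝ) < m := by exact_mod_cast h
  refine sub_RR (RR_pre m) (fun z hz => ⟨(RR_sub m hz).1, fun hb => ?_⟩) (z := ((m:ℝ) + 1/2, tp))
    (c.RR_top (by linarith)) (c.RR_top (by linarith))
  exact Set.disjoint_left.1 (c.LR_disj m) (c.bet_LL h hb) hz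
lemma LL_mono {k m : ℤ} (h : k ≤ m) : LL Up η k ⊆ LL Up η m := by
  rcases h.eq_or_lt with rfl | h
  · exact subset_rfl
  have hkm : (k:ℝ) < m := by exact_mod_cast h
  refine sub_LL (LL_pre k) (fun z hz => ⟨(LL_sub k hz).1, fun hb => ?_⟩) (z := ((k:ℝ) - 1/2, tp))
    (c.LL_top (by linarith)) (c.LL_top (by linarith))
  exact Set.disjoint_left.1 (c.LR_disj k) hz (c.bet_RR h hb)
/-- disjointness with ordering -/
lemma LR_disj' {k m : ℤ} (h : k ≤ m) {z : Strip} (h1 : z ∈ LL Up η k) (h2 : z ∈ RR Up η m) : False :=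
  Set.disjoint_left.1 (c.LR_disj m) (c.LL_mono h h1) h2
lemma bet_disj {k m : ℤ} (h : k ≠ m) {z : Strip} (h1 : z ∈ bet η {k}) : z ∉ bet η {m} := by
  intro h2
  rcases lt_or_gt_of_ne h with h | h
  · exact (LL_sub m (c.bet_LL h h1)).2 h2
  · exact (RR_sub m (c.bet_RR h h1)).2 h2

lemma compact_far {K : Set Strip} (hK : IsCompact K) (cK : IsPreconnected K) (hKU : K ⊆ pr ⁻¹' Up) :
    ∃ M : ℤ, ∀ k ≥ M, K ⊆ RR Up η (-k) ∧ K ⊆ LL Up η k := by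
  rcases K.eq_empty_or_nonempty with rfl | ⟨z, hz⟩
  · exact ⟨0, fun k _ => ⟨empty_subset _, empty_subset _⟩⟩
  obtain ⟨K', hK', cK', hKW, h1, h2⟩ := join_compact c.eac.oU c.eac.conU (hKU hz) (c.eac.topU (z := ((0:ℝ), tp)) rfl)
  have hc := hK.union hK'
  have cc : IsPreconnected (K ∪ K') := IsPreconnected.union z hz h1 cK cK'
  have hU : K ∪ K' ⊆ pr ⁻¹' Up := union_subset hKU hKW
  obtain ⟨B, hB⟩ := (hc.image continuous_fst).isBounded.exists_norm_le
  obtain ⟨M, hM⟩ := exists_int_gt (max B 0)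
  refine ⟨M, fun k hk => ?_⟩
  have hkM : (M:ℝ) ≤ k := by exact_mod_cast hk
  have hBk : B < k := lt_of_le_of_lt (le_max_left _ _) (hM.trans_le hkM)
  have h0k : 0 < (k:ℝ) := lt_of_le_of_lt (le_max_right _ _) (hM.trans_le hkM)
  constructor
  · refine subset_union_left.trans (sub_RR cc (fun z hz => ⟨hU hz, ?_⟩) (Or.inr h2) (c.RR_top (by push_cast; linarith)))
    rintro ⟨⟨_, rfl, e⟩, -⟩
    have := hB z.1 ⟨z, hz, rfl⟩
    rw [e] at this
    push_cast at this
    rw [norm_neg, Real.norm_eq_abs, abs_of_pos h0k] at this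
    linarith
  · refine subset_union_left.trans (sub_LL cc (fun z hz => ⟨hU hz, ?_⟩) (Or.inr h2) (c.LL_top (by linarith)))
    rintro ⟨⟨_, rfl, e⟩, -⟩
    have := hB z.1 ⟨z, hz, rfl⟩
    rw [e] at this
    rw [Real.norm_eq_abs, abs_of_pos h0k] at this
    linarith

omit c in
lemma bet_shift {k m : ℤ} {z : Strip} : shiftPt m z ∈ bet η {k + m} ↔ z ∈ bet η {k} := by
  simp [bet, shiftPt]
omit c in
lemma U_shift {m : ℤ} {z : Strip} : shiftPt m z ∈ pr ⁻¹' Up ↔ z ∈ pr ⁻¹' Up := by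
  rw [mem_preimage, pr_shift, mem_preimage]
lemma LL_shift' {k m : ℤ} {z : Strip} (h : z ∈ LL Up η k) : shiftPt m z ∈ LL Up η (k + m) := by
  refine sub_LL (P := shiftPt m '' LL Up η k) ((LL_pre k).image _ (shift_cont m).continuousOn) ?_
    (z := shiftPt m ((k:ℝ) - 1/2, tp)) ⟨_, c.LL_top (by linarith), rfl⟩ (c.LL_top (by push_cast; linarith)) ⟨z, h, rfl⟩
  rintro _ ⟨w, hw, rfl⟩
  exact ⟨U_shift.2 (LL_sub k hw).1, fun hb => (LL_sub k hw).2 (bet_shift.1 hb)⟩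
lemma RR_shift' {k m : ℤ} {z : Strip} (h : z ∈ RR Up η k) : shiftPt m z ∈ RR Up η (k + m) := by
  refine sub_RR (P := shiftPt m '' RR Up η k) ((RR_pre k).image _ (shift_cont m).continuousOn) ?_
    (z := shiftPt m ((k:ℝ) + 1/2, tp)) ⟨_, c.RR_top (by linarith), rfl⟩ (c.RR_top (by push_cast; linarith)) ⟨z, h, rfl⟩
  rintro _ ⟨w, hw, rfl⟩
  exact ⟨U_shift.2 (RR_sub k hw).1, fun hb => (RR_sub k hw).2 (bet_shift.1 hb)⟩
lemma LL_shift {k m : ℤ} {z : Strip} : shiftPt m z ∈ LL Up η (k + m) ↔ z ∈ LL Up η k := by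
  refine ⟨fun h => ?_, c.LL_shift'⟩
  have := c.LL_shift' (m := -m) h
  rw [shift_add] at this
  simpa [shift_zero] using this
lemma RR_shift {k m : ℤ} {z : Strip} : shiftPt m z ∈ RR Up η (k + m) ↔ z ∈ RR Up η k := by
  refine ⟨fun h => ?_, c.RR_shift'⟩
  have := c.RR_shift' (m := -m) h
  rw [shift_add] at this
  simpa [shift_zero] using this
end Cx


def ArcSet (A : Set Strip) (p q : Strip) : Prop :=
  ∃ γ : ℝ → Strip, ∃ a b : ℝ, a < b ∧ ContinuousOn γ (Icc a b) ∧ InjOn γ (Icc a b) ∧ γ a = p ∧ γ b = q ∧ γ '' Icc a b = A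

lemma ArcSet.concat {A B : Set Strip} {p q r : Strip} (hA : ArcSet A p q) (hB : ArcSet B q r) (hAB : A ∩ B ⊆ {q}) :
    ArcSet (A ∪ B) p r := by
  obtain ⟨γ, a, b, hab, hc, hi, ha, hb, him⟩ := hA
  obtain ⟨δ, a', b', hab', hc', hi', ha', hb', him'⟩ := hB
  classical
  set ε : ℝ → Strip := fun t => δ (t - b + a') with hε
  have hεc : ContinuousOn ε (Icc b (b + (b' - a'))) := by
    apply hc'.comp (by fun_prop)
    rintro t ⟨h1, h2⟩; constructor <;> linarith
  have hεi : ε '' Icc b (b + (b' - a')) = B := by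
    rw [← him']
    ext z; constructor
    · rintro ⟨t, ⟨h1, h2⟩, rfl⟩; exact ⟨t - b + a', ⟨by linarith, by linarith⟩, rfl⟩
    · rintro ⟨t, ⟨h1, h2⟩, rfl⟩; refine ⟨t + b - a', ⟨by linarith, by linarith⟩, ?_⟩
      simp only [hε]; congr 1; ring
  have hεj : InjOn ε (Icc b (b + (b' - a'))) := by
    rintro s ⟨h1, h2⟩ t ⟨h3, h4⟩ h
    have := hi' ⟨by linarith, by linarith⟩ ⟨by linarith, by linarith⟩ h
    linarith
  have hεb : ε b = q := by simp [hε, ha']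
  set φ : ℝ → Strip := fun t => if t ≤ b then γ t else ε t with hφ
  have h1 : ∀ t ∈ Icc a b, φ t = γ t := fun t ht => by simp [hφ, ht.2]
  have h2 : ∀ t ∈ Icc b (b + (b' - a')), φ t = ε t := fun t ht => by
    rcases ht.1.eq_or_lt with rfl | h
    · simp [hφ, hb, hεb]
    · simp [hφ, not_le.2 h]
  have hun : Icc a (b + (b' - a')) = Icc a b ∪ Icc b (b + (b' - a')) :=
    (Icc_union_Icc_eq_Icc hab.le (by linarith)).symm
  refine ⟨φ, a, b + (b' - a'), by linarith, ?_, ?_, ?_, ?_, ?_⟩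
  · rw [hun]
    exact (hc.congr h1).union_of_isClosed (hεc.congr h2) isClosed_Icc isClosed_Icc
  · have key : ∀ s ∈ Icc a b, ∀ t ∈ Icc b (b + (b' - a')), φ s = φ t → s = t := by
      intro s hs t ht h
      have h3 : φ s ∈ A := by rw [h1 s hs, ← him]; exact ⟨s, hs, rfl⟩
      have h4 : φ s ∈ B := by rw [h, h2 t ht, ← hεi]; exact ⟨t, ht, rfl⟩
      have h5 : φ s = q := hAB ⟨h3, h4⟩
      have e1 : s = b := hi hs ⟨hab.le, le_rfl⟩ (by rw [← h1 s hs, h5, hb])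
      have e2 : t = b := hεj ht ⟨le_rfl, by linarith⟩ (by rw [← h2 t ht, ← h, h5, hεb])
      rw [e1, e2]
    rw [hun]
    rintro s (hs | hs) t (ht | ht) h
    · rw [h1 s hs, h1 t ht] at h; exact hi hs ht h
    · exact key s hs t ht h
    · exact (key t ht s hs h.symm).symm
    · rw [h2 s hs, h2 t ht] at h; exact hεj hs ht h
  · rw [h1 a ⟨le_rfl, hab.le⟩, ha]
  · rw [h2 _ ⟨by linarith, le_rfl⟩, ← hb']; simp only [hε]; congr 1; ring
  · rw [hun, image_union, ← him, ← hεi]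
    congr 1
    · exact image_congr h1
    · exact image_congr h2

lemma ArcSet.first_hit {A : Set Strip} {p q : Strip} (hA : ArcSet A p q) {F : Set Strip} (hF : IsClosed F) (hp : p ∉ F) (hq : q ∈ F) :
    ∃ A' q', A' ⊆ A ∧ q' ∈ F ∧ q' ∈ A ∧ ArcSet A' p q' ∧ A' ∩ F ⊆ {q'} := by
  obtain ⟨γ, a, b, hab, hc, hi, ha, hb, him⟩ := hA
  have hcl : IsClosed (Icc a b ∩ γ ⁻¹' F) := hc.preimage_isClosed_of_isClosed isClosed_Icc hF
  have hcp : IsCompact (Icc a b ∩ γ ⁻¹' F) := isCompact_Icc.of_isClosed_subset hcl inter_subset_left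
  obtain ⟨t, ht, htm⟩ := hcp.exists_isLeast ⟨b, ⟨hab.le, le_rfl⟩, by simpa [hb] using hq⟩
  have hat : a < t := by
    rcases ht.1.1.eq_or_lt with h | h
    · exfalso; apply hp; have := ht.2; rw [← h, mem_preimage, ha] at this; exact this
    · exact h
  have hs : Icc a t ⊆ Icc a b := Icc_subset_Icc_right ht.1.2
  refine ⟨γ '' Icc a t, γ t, ?_, ht.2, ?_, ⟨γ, a, t, hat, hc.mono hs, hi.mono hs, ha, rfl, rfl⟩, ?_⟩
  · rw [← him]; exact image_mono hs
  · rw [← him]; exact ⟨t, ht.1, rfl⟩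
  · rintro _ ⟨⟨s, hs', rfl⟩, hsF⟩
    have := htm ⟨hs hs', hsF⟩
    have : s = t := le_antisymm hs'.2 this
    rw [this]; rfl

lemma seg_arc {c p q : Strip} {δ : ℝ} (hp : p ∈ Metric.closedBall c δ) (hq : q ∈ Metric.closedBall c δ) (hpq : p ≠ q) :
    ∃ A ⊆ Metric.closedBall c δ, ArcSet A p q := by
  set γ : ℝ → Strip := fun t => (p.1 + t * (q.1 - p.1), projIcc (-1:ℝ) 1 (by norm_num) (p.2 + t * (q.2 - p.2))) with hγ
  have hc : Continuous γ := by
    have : Continuous (projIcc (-1:ℝ) 1 (by norm_num)) := continuous_projIcc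
    exact (by fun_prop : Continuous fun t => p.1 + t * (q.1 - p.1)).prodMk (this.comp (by fun_prop))
  have hv : ∀ t ∈ Icc (0:ℝ) 1, ((γ t).2 : ℝ) = p.2 + t * (q.2 - p.2) := by
    intro t ht
    have : (p.2 + t * (q.2 - p.2) : ℝ) ∈ Icc (-1:ℝ) 1 := by
      have h1 := p.2.2; have h2 := q.2.2; obtain ⟨h3, h4⟩ := ht
      constructor
      · nlinarith [h1.1, h2.1]
      · nlinarith [h1.2, h2.2]
    simp only [hγ]
    rw [projIcc_of_mem _ this]
  refine ⟨γ '' Icc 0 1, ?_, γ, 0, 1, by norm_num, hc.continuousOn, ?_, ?_, ?_, rfl⟩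
  · rintro _ ⟨t, ht, rfl⟩
    rw [Metric.mem_closedBall, Prod.dist_eq, max_le_iff, Real.dist_eq, Subtype.dist_eq, Real.dist_eq] at *
    rw [hv t ht]
    have conv : ∀ x y z : ℝ, |x - z| ≤ δ → |y - z| ≤ δ → |x + t * (y - x) - z| ≤ δ := by
      intro x y z h1 h2
      obtain ⟨h3, h4⟩ := ht
      rw [abs_le] at *
      constructor <;> nlinarith
    exact ⟨conv _ _ _ hp.1 hq.1, conv _ _ _ hp.2 hq.2⟩
  · intro s hs t ht h
    by_contra hst
    have h1 := congrArg Prod.fst h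
    have h2 := congrArg (fun z : Strip => (z.2 : ℝ)) h
    simp only [hv s hs, hv t ht] at h2
    simp only [hγ] at h1
    apply hpq
    refine Prod.ext ?_ (Subtype.ext ?_)
    · have : (s - t) * (q.1 - p.1) = 0 := by linarith
      rcases mul_eq_zero.1 this with h | h
      · exact absurd (sub_eq_zero.1 h) hst
      · linarith
    · have : (s - t) * ((q.2:ℝ) - p.2) = 0 := by linarith
      rcases mul_eq_zero.1 this with h | h
      · exact absurd (sub_eq_zero.1 h) hst
      · linarith
  · simp [hγ]
  · simp [hγ]

lemma arc_in_open {W : Set Strip} (hW : IsOpen W) (cW : IsPreconnected W) {p q : Strip} (hp : p ∈ W) (hq : q ∈ W) (hpq : p ≠ q) :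
    ∃ A ⊆ W, ArcSet A p q := by
  set S : Set Strip := {q | q ∈ W ∧ (q = p ∨ ∃ A ⊆ W, ArcSet A p q)} with hS
  have key : ∀ c δ, Metric.closedBall c δ ⊆ W → ∀ s ∈ Metric.closedBall c δ, s ∈ S → Metric.closedBall c δ ⊆ S := by
    intro c δ hB s hs hsS q hq
    refine ⟨hB hq, ?_⟩
    by_cases hqp : q = p
    · exact Or.inl hqp
    right
    by_cases hpB : p ∈ Metric.closedBall c δ
    · obtain ⟨A, hA, hA'⟩ := seg_arc hpB hq (Ne.symm hqp)
      exact ⟨A, hA.trans hB, hA'⟩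
    · obtain ⟨-, h | ⟨A, hAW, hA⟩⟩ := hsS
      · exact absurd (h ▸ hs) hpB
      obtain ⟨A', q', hA'A, hq'F, -, hA', hintg⟩ := hA.first_hit Metric.isClosed_closedBall hpB hs
      by_cases hqq : q' = q
      · exact ⟨A', hA'A.trans hAW, hqq ▸ hA'⟩
      obtain ⟨B, hB1, hB2⟩ := seg_arc hq'F hq hqq
      exact ⟨A' ∪ B, union_subset (hA'A.trans hAW) (hB1.trans hB), hA'.concat hB2 ((inter_subset_inter_right _ hB1).trans hintg)⟩
  have ball : ∀ c ∈ W, ∃ δ > 0, Metric.closedBall c δ ⊆ W := fun c hc =>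
    Metric.nhds_basis_closedBall.mem_iff.1 (hW.mem_nhds hc)
  have o1 : IsOpen S := by
    rw [isOpen_iff_mem_nhds]
    intro c hc
    obtain ⟨δ, hδ, hB⟩ := ball c hc.1
    exact mem_of_superset (Metric.closedBall_mem_nhds c hδ) (key c δ hB c (Metric.mem_closedBall_self hδ.le) hc)
  have o2 : IsOpen (W \ S) := by
    rw [isOpen_iff_mem_nhds]
    intro c hc
    obtain ⟨δ, hδ, hB⟩ := ball c hc.1
    refine mem_of_superset (Metric.closedBall_mem_nhds c hδ) (fun s hs => ⟨hB hs, fun hsS => hc.2 ?_⟩)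
    exact key c δ hB s hs hsS (Metric.mem_closedBall_self hδ.le)
  have : W ⊆ S := cW.subset_left_of_subset_union o1 o2 disjoint_sdiff_right
    (fun z hz => by by_cases h : z ∈ S; exacts [Or.inl h, Or.inr ⟨hz, h⟩]) ⟨p, hp, hp, Or.inl rfl⟩
  exact (this hq).2.resolve_left (Ne.symm hpq)

lemma ArcSet.toArc {A U : Set Strip} {p x : Strip} (hA : ArcSet A p x) (hU : ∀ z ∈ A, z ≠ x → z ∈ U) :
    ∃ γ : unitInterval → Strip, IsArcTo U γ x ∧ γ 0 = p ∧ range γ = A := by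
  obtain ⟨γ, a, b, hab, hc, hi, ha, hb, him⟩ := hA
  have hm : ∀ t : unitInterval, a + t * (b - a) ∈ Icc a b := by
    intro t; have := t.2; constructor <;> nlinarith [t.2.1, t.2.2]
  have hinj : Injective (fun t : unitInterval => γ (a + t * (b - a))) := by
    intro s t h
    have := hi (hm s) (hm t) h
    have h2 : ((s:ℝ) - t) * (b - a) = 0 := by linarith
    rcases mul_eq_zero.1 h2 with h | h
    · exact Subtype.ext (sub_eq_zero.1 h)
    · linarith
  have h1 : γ (a + ((1 : unitInterval) : ℝ) * (b - a)) = x := by rw [← hb]; congr 1; simp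
  refine ⟨fun t => γ (a + t * (b - a)), ⟨?_, hinj, ?_, h1⟩, by simpa using ha, ?_⟩
  · exact hc.comp_continuous (by fun_prop) hm
  · intro t ht
    apply hU
    · rw [← him]; exact ⟨_, hm t, rfl⟩
    · intro h
      apply ht
      exact hinj (h.trans h1.symm)
  · rw [← him]
    ext z; constructor
    · rintro ⟨t, rfl⟩; exact ⟨_, hm t, rfl⟩
    · rintro ⟨t, ⟨ht1, ht2⟩, rfl⟩
      have hpos : 0 < b - a := by linarith
      refine ⟨⟨(t - a) / (b - a), by apply div_nonneg <;> linarith, by rw [div_le_one hpos]; linarith⟩, ?_⟩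
      simp only; congr 1; field_simp; ring

lemma prec_of {A B U : Set Strip} {a b : ℝ} {x x' : Strip} (hA : ArcSet A (a, tp) x) (hB : ArcSet B (b, tp) x')
    (hAU : ∀ z ∈ A, z ≠ x → z ∈ U) (hBU : ∀ z ∈ B, z ≠ x' → z ∈ U) (hd : Disjoint A B) (hab : a < b) : PrecB 1 U x x' := by
  obtain ⟨γ, h1, h2, h3⟩ := hA.toArc hAU
  obtain ⟨γ', h1', h2', h3'⟩ := hB.toArc hBU
  exact ⟨γ, γ', h1, h1', by rw [h2], by rw [h2'], by rw [h3, h3']; exact hd, by rw [h2, h2']; exact hab⟩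

def Bv (η : II) (k : ℤ) : Set Strip := {z | z.1 = (k:ℝ) ∧ η ≤ z.2}
lemma vert_arc {η : II} (hη : η < tp) (k : ℤ) : ArcSet (Bv η k) ((k:ℝ), tp) (xk η k) := by
  have hη' : (η:ℝ) < 1 := hη
  have hη1 := η.2.1
  have hv : ∀ t ∈ Icc (0:ℝ) (1 - η), (projIcc (-1:ℝ) 1 (by norm_num) (1 - t) : ℝ) = 1 - t := by
    rintro t ⟨h1, h2⟩
    rw [projIcc_of_mem _ ⟨by linarith, by linarith⟩]
  refine ⟨fun t => ((k:ℝ), projIcc (-1:ℝ) 1 (by norm_num) (1 - t)), 0, 1 - η, by linarith, ?_, ?_, ?_, ?_, ?_⟩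
  · exact (continuous_const.prodMk (continuous_projIcc.comp (by fun_prop))).continuousOn
  · intro s hs t ht h
    have := congrArg (fun z : Strip => (z.2 : ℝ)) h
    simp only [hv s hs, hv t ht] at this
    linarith
  · simp
  · simp [xk]
  · ext ⟨x, y⟩
    simp only [mem_image, Bv, mem_ofPred_eq, Prod.mk.injEq]
    constructor
    · rintro ⟨t, ht, rfl, rfl⟩
      refine ⟨rfl, ?_⟩
      show (η:ℝ) ≤ _
      rw [hv t ht]; linarith [ht.2]
    · rintro ⟨rfl, h⟩
      have h' : (η:ℝ) ≤ y := h
      have h2 := y.2.2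
      refine ⟨1 - y, ⟨by linarith, by linarith⟩, rfl, ?_⟩
      simp


namespace Cx
variable {X Um Up : Set Ann} {η : II} (c : Cx X Um Up η)
include c

lemma Bv_U {k : ℤ} {z : Strip} (hz : z ∈ Bv η k) (hne : z ≠ xk η k) : z ∈ bet η {k} := by
  obtain ⟨h1, h2⟩ := hz
  refine ⟨⟨k, rfl, h1⟩, lt_of_le_of_ne h2 (fun h => hne (Prod.ext h1 h.symm))⟩
omit c in
lemma bet_univ {k : ℤ} : bet η {k} ⊆ bet η univ := by
  rintro z ⟨⟨m, _, e⟩, h⟩; exact ⟨⟨m, mem_univ _, e⟩, h⟩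

lemma V_top {k : ℤ} {x : ℝ} (h1 : (k:ℝ) < x) (h2 : x < k + 1) : (x, tp) ∈ Cmp Up η univ ((k:ℝ) + 1/2) := by
  refine c.cmp_eq (I := Ioo (k:ℝ) (k+1)) ordConnected_Ioo ?_ ⟨by linarith, by linarith⟩ ⟨h1, h2⟩
  rintro y ⟨h3, h4⟩ m - rfl
  have h3' : k < m := by exact_mod_cast h3
  have h4' : m < k + 1 := by exact_mod_cast h4
  omega
lemma V_RR {k : ℤ} : Cmp Up η univ ((k:ℝ) + 1/2) ⊆ RR Up η k :=
  sub_RR isPreconnected_connectedComponentIn ((connectedComponentIn_subset _ _).trans (diff_subset_diff_right bet_univ))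
    (c.V_top (x := (k:ℝ) + 1/2) (by linarith) (by linarith)) (c.RR_top (by linarith))
lemma V_LL {k : ℤ} : Cmp Up η univ ((k:ℝ) + 1/2) ⊆ LL Up η (k+1) :=
  sub_LL isPreconnected_connectedComponentIn ((connectedComponentIn_subset _ _).trans (diff_subset_diff_right bet_univ))
    (c.V_top (x := (k:ℝ) + 1/2) (by linarith) (by linarith)) (c.LL_top (by push_cast; linarith))

lemma sub_V {T : Set Strip} (hT : IsPreconnected T) (hne : T.Nonempty) (hs : T ⊆ pr ⁻¹' Up \ bet η univ) :
    ∃ k : ℤ, T ⊆ Cmp Up η univ ((k:ℝ) + 1/2) := by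
  obtain ⟨z, hz⟩ := hne
  obtain ⟨x, ⟨m, -, hx1, hx2⟩, hc⟩ := c.climb univ ⟨0, mem_univ _⟩ (hs hz)
  have h1 : T ⊆ connectedComponentIn (pr ⁻¹' Up \ bet η univ) z := hT.subset_connectedComponentIn hz hs
  have key : ∀ k : ℤ, (k:ℝ) < x → x < k + 1 → T ⊆ Cmp Up η univ ((k:ℝ) + 1/2) := by
    intro k h2 h3
    have h4 := c.V_top h2 h3
    unfold Cmp at h4 ⊢
    rw [connectedComponentIn_eq h4, ← connectedComponentIn_eq hc]
    exact h1
  rw [abs_lt] at hx2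
  rcases lt_or_gt_of_ne (sub_ne_zero.1 (abs_pos.1 hx1)) with h | h
  · exact ⟨m - 1, key _ (by push_cast; linarith) (by push_cast; linarith)⟩
  · exact ⟨m, key _ (by linarith) (by linarith)⟩

omit c in
lemma shift_xk (k : ℤ) : shiftPt k (xk η 0) = xk η k := by simp [shiftPt, xk]

lemma idx_sub {τ : ℝ → Strip} {t0 : ℝ} (ht0 : t0 < 1) (hc : ContinuousOn τ (Icc t0 1)) (hi : InjOn τ (Icc t0 1)) {x : Strip} (h1 : τ 1 = x)
    (hx : pr x ∈ X) {k : ℤ} (hV : ∀ t ∈ Ico t0 1, τ t ∈ Cmp Up η univ ((k:ℝ) + 1/2)) (n1 : x ≠ xk η k) (n2 : x ≠ xk η (k+1)) :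
    AccIdxB 1 (pr ⁻¹' Up) x (xk η 0) k := by
  set V := Cmp Up η univ ((k:ℝ) + 1/2) with hVdef
  have hVU : V ⊆ pr ⁻¹' Up \ bet η univ := connectedComponentIn_subset _ _
  have hVo : IsOpen V := (c.diff_open _).connectedComponentIn
  have hVc : IsPreconnected V := isPreconnected_connectedComponentIn
  have hxU : x ∉ pr ⁻¹' Up := fun h => c.eac.notX_of_Up h hx
  set p : Strip := ((k:ℝ) + 1/2, tp) with hp
  have hpV : p ∈ V := c.V_top (by linarith) (by linarith)
  have hsubarc : ∀ s ∈ Ico t0 1, ArcSet (τ '' Icc s 1) (τ s) x := by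
    intro s hs
    have hss : Icc s 1 ⊆ Icc t0 1 := Icc_subset_Icc_left hs.1
    exact ⟨τ, s, 1, hs.2, hc.mono hss, hi.mono hss, rfl, h1, rfl⟩
  have hsubV : ∀ s ∈ Ico t0 1, ∀ z ∈ τ '' Icc s 1, z ∈ V ∨ z = x := by
    rintro s hs _ ⟨t, ht, rfl⟩
    rcases ht.2.eq_or_lt with rfl | h
    · exact Or.inr h1
    · exact Or.inl (hV t ⟨hs.1.trans ht.1, h⟩)
  have hF : IsClosed (τ '' Icc t0 1) := (isCompact_Icc.image_of_continuousOn hc).isClosed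
  have hmem : ∀ z ∈ τ '' Icc t0 1, z ∈ V → ∃ s ∈ Ico t0 1, τ s = z := by
    rintro _ ⟨s, hs, rfl⟩ hz
    rcases hs.2.eq_or_lt with rfl | h
    · rw [h1] at hz; exact absurd (hVU hz).1 hxU
    · exact ⟨s, ⟨hs.1, h⟩, rfl⟩
  obtain ⟨A, hA, hAV⟩ : ∃ A, ArcSet A p x ∧ ∀ z ∈ A, z ∈ V ∨ z = x := by
    by_cases hpF : p ∈ τ '' Icc t0 1
    · obtain ⟨s, hs, hsp⟩ := hmem p hpF hpV
      exact ⟨_, hsp ▸ hsubarc s hs, hsubV s hs⟩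
    · have ht0m : τ t0 ∈ τ '' Icc t0 1 := ⟨t0, ⟨le_rfl, ht0.le⟩, rfl⟩
      obtain ⟨B, hBV, hB⟩ := arc_in_open hVo hVc hpV (hV t0 ⟨le_rfl, ht0⟩) (fun h => hpF (h ▸ ht0m))
      obtain ⟨B', q', hB'B, hq'F, hq'B, hB', hintg⟩ := hB.first_hit hF hpF ht0m
      obtain ⟨s, hs, hsq⟩ := hmem q' hq'F (hBV hq'B)
      refine ⟨B' ∪ τ '' Icc s 1, hB'.concat (hsq ▸ hsubarc s hs) ?_, ?_⟩
      · exact (inter_subset_inter_right _ (image_mono (Icc_subset_Icc_left hs.1))).trans hintg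
      · rintro z (hz | hz)
        · exact Or.inl (hBV (hB'B hz))
        · exact hsubV s hs z hz
  have hAU : ∀ z ∈ A, z ≠ x → z ∈ pr ⁻¹' Up := fun z hz hne => (hVU ((hAV z hz).resolve_right hne)).1
  have hBU : ∀ m, ∀ z ∈ Bv η m, z ≠ xk η m → z ∈ pr ⁻¹' Up := fun m z hz hne => c.bet_U _ (c.Bv_U hz hne)
  have hdis : ∀ m, x ≠ xk η m → Disjoint A (Bv η m) := by
    intro m hm
    rw [Set.disjoint_left]
    intro z hz hzB
    by_cases hzx : z = xk η m
    · rcases hAV z hz with h | h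
      · exact c.xk_notU m (hzx ▸ (hVU h).1)
      · exact hm (h ▸ hzx)
    · have hb := c.Bv_U hzB hzx
      rcases hAV z hz with h | h
      · exact (hVU h).2 (bet_univ hb)
      · exact hxU (h ▸ c.bet_U _ hb)
  constructor
  · right
    rw [shift_xk]
    exact prec_of (vert_arc c.eta_lt k) hA (hBU k) hAU (hdis k n1).symm (by linarith)
  · rw [shift_xk]
    exact prec_of hA (vert_arc c.eta_lt (k+1)) hAU (hBU _) (hdis _ n2) (by push_cast; linarith)

lemma index {τ : ℝ → Strip} (hc : ContinuousOn τ (Icc 0 1)) (hi : InjOn τ (Icc 0 1)) {x : Strip} (h1 : τ 1 = x)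
    (hx : pr x ∈ X) (hU : ∀ t ∈ Ico (0:ℝ) 1, τ t ∈ pr ⁻¹' Up) :
    ∃ k : ℤ, AccIdxB 1 (pr ⁻¹' Up) x (xk η 0) k ∧ ∃ t0 ∈ Ico (0:ℝ) 1, ∀ t ∈ Ico t0 1, τ t ∈ RR Up η (k-1) ∧ τ t ∈ LL Up η (k+1) := by
  have hxU : x ∉ pr ⁻¹' Up := fun h => c.eac.notX_of_Up h hx
  have hct : ContinuousWithinAt τ (Icc 0 1) 1 := hc 1 ⟨by norm_num, le_rfl⟩
  have avoid : ∀ S : Set ℤ, (∀ k ∈ S, x ≠ xk η k) → ∃ t0 ∈ Ico (0:ℝ) 1, ∀ t ∈ Ico t0 1, τ t ∉ bet η S := by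
    intro S hS
    have hxc : x ∉ {z : Strip | (∃ k ∈ S, z.1 = (k:ℝ)) ∧ η ≤ z.2} := by
      rintro ⟨⟨k, hk, e⟩, h⟩
      exact hxU (c.bet_U _ (c.Bv_U (k := k) ⟨e, h⟩ (hS k hk)))
    have hev := hct.eventually ((bet_closed (η := η) S).isOpen_compl.mem_nhds (h1 ▸ hxc))
    rw [eventually_nhdsWithin_iff, Metric.eventually_nhds_iff] at hev
    obtain ⟨ε, hε, hh⟩ := hev
    refine ⟨max 0 (1 - ε/2), ⟨le_max_left _ _, max_lt (by norm_num) (by linarith)⟩, fun t ht hb => ?_⟩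
    have h2 := (le_max_left _ _).trans ht.1
    have h3 := (le_max_right _ _).trans ht.1
    refine hh (y := t) ?_ ⟨h2, ht.2.le⟩ ⟨hb.1, hb.2.le⟩
    rw [Real.dist_eq, abs_lt]; constructor <;> linarith [ht.2]
  have pre : ∀ t0 ∈ Ico (0:ℝ) 1, IsPreconnected (τ '' Ico t0 1) ∧ (τ '' Ico t0 1).Nonempty := by
    intro t0 ht0
    refine ⟨isPreconnected_Ico.image _ (hc.mono (fun t ht => ⟨ht0.1.trans ht.1, ht.2.le⟩)), ⟨_, t0, ⟨le_rfl, ht0.2⟩, rfl⟩⟩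
  have fin : ∀ t0 ∈ Ico (0:ℝ) 1, ∀ k : ℤ, τ '' Ico t0 1 ⊆ Cmp Up η univ ((k:ℝ) + 1/2) → x ≠ xk η k → x ≠ xk η (k+1) →
      AccIdxB 1 (pr ⁻¹' Up) x (xk η 0) k ∧ ∃ t0 ∈ Ico (0:ℝ) 1, ∀ t ∈ Ico t0 1, τ t ∈ RR Up η (k-1) ∧ τ t ∈ LL Up η (k+1) := by
    intro t0 ht0 k hV n1 n2
    have hs : Icc t0 1 ⊆ Icc (0:ℝ) 1 := Icc_subset_Icc_left ht0.1
    refine ⟨c.idx_sub ht0.2 (hc.mono hs) (hi.mono hs) h1 hx (fun t ht => hV ⟨t, ht, rfl⟩) n1 n2, t0, ht0, fun t ht => ?_⟩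
    have := hV ⟨t, ht, rfl⟩
    exact ⟨c.RR_mono (by omega) (c.V_RR this), c.V_LL this⟩
  by_cases hxj : ∃ j, x = xk η j
  · obtain ⟨j, hj⟩ := hxj
    have xk_inj : ∀ m, m ≠ j → x ≠ xk η m := by
      intro m hm h
      rw [hj] at h
      have := congrArg Prod.fst h
      simp only [xk] at this
      exact hm (by exact_mod_cast this.symm)
    obtain ⟨t0, ht0, hav⟩ := avoid {j}ᶜ (fun k hk => xk_inj k hk)
    obtain ⟨hp, hne⟩ := pre t0 ht0
    have hTU : ∀ z ∈ τ '' Ico t0 1, z ∈ pr ⁻¹' Up := by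
      rintro _ ⟨t, ht, rfl⟩; exact hU t ⟨ht0.1.trans ht.1, ht.2⟩
    have hTb : ∀ m, m ≠ j → τ '' Ico t0 1 ⊆ pr ⁻¹' Up \ bet η {m} := by
      rintro m hm z hz
      refine ⟨hTU z hz, ?_⟩
      obtain ⟨t, ht, rfl⟩ := hz
      rintro ⟨⟨_, rfl, e⟩, h⟩
      exact hav t ht ⟨⟨_, hm, e⟩, h⟩
    have dich : ∀ m, m ≠ j → τ '' Ico t0 1 ⊆ LL Up η m ∨ τ '' Ico t0 1 ⊆ RR Up η m := by
      intro m hm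
      obtain ⟨z, hz⟩ := hne
      rcases c.LR_cover (hTb m hm hz) with h | h
      · exact Or.inl (sub_LL hp (hTb m hm) hz h)
      · exact Or.inr (sub_RR hp (hTb m hm) hz h)
    have hTuniv : (∀ z ∈ τ '' Ico t0 1, z ∉ bet η {j}) → τ '' Ico t0 1 ⊆ pr ⁻¹' Up \ bet η univ := by
      intro h z hz
      refine ⟨hTU z hz, ?_⟩
      rintro ⟨⟨m, -, e⟩, hh⟩
      by_cases hm : m = j
      · exact h z hz ⟨⟨m, hm, e⟩, hh⟩
      · exact (hTb m hm hz).2 ⟨⟨m, rfl, e⟩, hh⟩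
    rcases dich (j-1) (by omega) with hL | hR
    · obtain ⟨k, hk⟩ := c.sub_V hp hne (hTuniv (fun z hz hb =>
        Set.disjoint_left.1 (c.LR_disj (j-1)) (hL hz) (c.bet_RR (by omega) hb)))
      obtain ⟨z, hz⟩ := hne
      have : k < j - 1 := by
        by_contra hcon
        exact c.LR_disj' (not_lt.1 hcon) (hL hz) (c.V_RR (hk hz))
      exact ⟨k, fin t0 ht0 k hk (xk_inj _ (by omega)) (xk_inj _ (by omega))⟩
    rcases dich (j+1) (by omega) with hL | hR'
    · refine ⟨j, ⟨Or.inl (by rw [shift_xk, hj]), ?_⟩, t0, ht0, fun t ht => ⟨hR ⟨t, ht, rfl⟩, hL ⟨t, ht, rfl⟩⟩⟩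
      rw [shift_xk, hj]
      refine prec_of (vert_arc c.eta_lt j) (vert_arc c.eta_lt (j+1)) (fun z hz hne => c.bet_U _ (c.Bv_U hz hne))
        (fun z hz hne => c.bet_U _ (c.Bv_U hz hne)) ?_ (by push_cast; linarith)
      rw [Set.disjoint_left]
      rintro z ⟨h1, -⟩ ⟨h2, -⟩
      rw [h1] at h2; push_cast at h2; linarith
    · obtain ⟨k, hk⟩ := c.sub_V hp hne (hTuniv (fun z hz hb =>
        Set.disjoint_left.1 (c.LR_disj (j+1)) (c.bet_LL (by omega) hb) (hR' hz)))
      obtain ⟨z, hz⟩ := hne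
      have : j + 1 < k + 1 := by
        by_contra hcon
        exact c.LR_disj' (not_lt.1 hcon) (c.V_LL (hk hz)) (hR' hz)
      exact ⟨k, fin t0 ht0 k hk (xk_inj _ (by omega)) (xk_inj _ (by omega))⟩
  · push Not at hxj
    obtain ⟨t0, ht0, hav⟩ := avoid univ (fun k _ => hxj k)
    obtain ⟨hp, hne⟩ := pre t0 ht0
    obtain ⟨k, hk⟩ := c.sub_V hp hne (by
      rintro _ ⟨t, ht, rfl⟩; exact ⟨hU t ⟨ht0.1.trans ht.1, ht.2⟩, hav t ht⟩)
    exact ⟨k, fin t0 ht0 k hk (hxj _) (hxj _)⟩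
end Cx


lemma haslog_step {R : Set Strip} {p p' : Strip} {r : ℝ} (hr : ∀ z ∈ R, r ≤ dist z p) (hd : 2 * dist p' p < r)
    (h : HasLog R (fun z => cx z - cx p)) : HasLog R (fun z => cx z - cx p') := by
  refine perturb (u := fun z => cx z - cx p) (cx_cont.sub continuous_const).continuousOn (cx_cont.sub continuous_const).continuousOn ?_ h
  intro z hz
  have h1 := cx_norm_ge z p
  have h2 := cx_norm_le p p'
  have h3 := hr z hz
  rw [dist_comm] at h2
  have : cx z - cx p' - (cx z - cx p) = cx p - cx p' := by ring
  rw [this]; linarith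

lemma haslog_all {L R : Set Strip} (hL : IsOpen L) (cL : IsPreconnected L) (hd : Disjoint L R)
    {p0 : Strip} (hp0 : p0 ∈ L) (ht : p0.2 = tp) : ∀ p ∈ L, HasLog R (fun z => cx z - cx p) := by
  have key : ∀ p ∈ L, ∃ ε > 0, ∀ p', dist p' p < ε → p' ∈ L ∧
      (HasLog R (fun z => cx z - cx p) ↔ HasLog R (fun z => cx z - cx p')) := by
    intro p hp
    obtain ⟨r, hr, hb⟩ := Metric.isOpen_iff.1 hL p hp
    have hR : ∀ z ∈ R, r ≤ dist z p := by
      intro z hz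
      by_contra hcon
      push Not at hcon
      exact Set.disjoint_left.1 hd (hb hcon) hz
    refine ⟨r/4, by linarith, fun p' h => ⟨hb (by rw [Metric.mem_ball]; linarith), ?_, ?_⟩⟩
    · exact haslog_step hR (by linarith)
    · refine haslog_step (r := 3*r/4) (fun z hz => ?_) (by rw [dist_comm]; linarith)
      have := hR z hz
      have := dist_triangle z p' p
      linarith
  have hsub := cL.subset_left_of_subset_union (u := {p | p ∈ L ∧ HasLog R (fun z => cx z - cx p)})
    (v := {p | p ∈ L ∧ ¬ HasLog R (fun z => cx z - cx p)}) ?_ ?_ ?_ ?_ ?_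
  · exact fun p hp => (hsub hp).2
  · rw [Metric.isOpen_iff]
    rintro p ⟨hp, h⟩
    obtain ⟨ε, hε, hh⟩ := key p hp
    exact ⟨ε, hε, fun p' hp' => ⟨(hh p' hp').1, (hh p' hp').2.1 h⟩⟩
  · rw [Metric.isOpen_iff]
    rintro p ⟨hp, h⟩
    obtain ⟨ε, hε, hh⟩ := key p hp
    exact ⟨ε, hε, fun p' hp' => ⟨(hh p' hp').1, fun h' => h ((hh p' hp').2.2 h')⟩⟩
  · rw [Set.disjoint_left]; exact fun p h1 h2 => h2.2 h1.2
  · intro p hp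
    by_cases h : HasLog R (fun z => cx z - cx p)
    · exact Or.inl ⟨hp, h⟩
    · exact Or.inr ⟨hp, h⟩
  · refine ⟨p0, hp0, hp0, HasLog.of_slit Complex.I Complex.I_ne_zero (cx_cont.sub continuous_const).continuousOn ?_⟩
    intro z hz
    have hne : cx z - cx p0 ≠ 0 := by
      apply cx_sub_ne
      rintro rfl
      exact Set.disjoint_left.1 hd hp0 hz
    have him : (cx z - cx p0).im ≤ 0 := by
      simp only [Complex.sub_im, cx_im, ht]
      have := z.2.2.2
      show (z.2:ℝ) - 1 ≤ 0
      linarith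
    rw [Complex.mem_slitPlane_iff]
    simp only [Complex.I_mul_re, Complex.I_mul_im]
    by_contra hcon
    push Not at hcon
    apply hne
    apply Complex.ext
    · exact hcon.2
    · simp only [Complex.zero_im]; linarith [hcon.1]

lemma joint_log {L R : Set Strip} (hL : IsOpen L) (hR : IsOpen R) (cL : IsPreconnected L) (cR : IsPreconnected R)
    (hd : Disjoint L R) {p0 z0 : Strip} (hp0 : p0 ∈ L) (hpt : p0.2 = tp) (hz0 : z0 ∈ R) (hzt : z0.2 = tp) :
    HasLog (L ×ˢ R) (fun q : Strip × Strip => cx q.2 - cx q.1) := by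
  have H := haslog_all hL cL hd hp0 hpt
  obtain ⟨h, hh, he⟩ := haslog_all hR cR hd.symm hz0 hzt z0 hz0
  choose! g hg hge using H
  have hne : ∀ p ∈ L, ∀ z ∈ R, cx z - cx p ≠ 0 := by
    intro p hp z hz
    apply cx_sub_ne
    rintro rfl
    exact Set.disjoint_left.1 hd hp hz
  refine ⟨fun q => g q.1 q.2 - g q.1 z0 + (h q.1 + Real.pi * Complex.I), ?_, ?_⟩
  · rintro ⟨p1, z1⟩ ⟨hp1, hz1⟩
    simp only at hp1 hz1
    obtain ⟨r, hr, hb⟩ := Metric.isOpen_iff.1 hL p1 hp1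
    have hRr : ∀ z ∈ R, r ≤ dist z p1 := by
      intro z hz
      by_contra hcon
      push Not at hcon
      exact Set.disjoint_left.1 hd (hb hcon) hz
    set B := Metric.ball p1 (r/2) with hB
    have hBL : B ⊆ L := (Metric.ball_subset_ball (by linarith)).trans hb
    have slit : ∀ p ∈ B, ∀ z ∈ R, (cx z - cx p) / (cx z - cx p1) ∈ Complex.slitPlane := by
      intro p hp z hz
      apply slit_div
      have h1 := cx_norm_ge z p1
      have h2 := cx_norm_le p1 p
      have h3 := hRr z hz
      rw [dist_comm] at h2
      have h4 : dist p p1 < r/2 := hp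
      have : cx z - cx p - (cx z - cx p1) = cx p1 - cx p := by ring
      rw [this]; linarith
    have eq : ∀ q ∈ B ×ˢ R, g q.1 q.2 - g q.1 z0 + (h q.1 + Real.pi * Complex.I) =
        (g p1 q.2 + Complex.log ((cx q.2 - cx q.1) / (cx q.2 - cx p1))) -
        (g p1 z0 + Complex.log ((cx z0 - cx q.1) / (cx z0 - cx p1))) + (h q.1 + Real.pi * Complex.I) := by
      rintro ⟨p, z⟩ ⟨hp, hz⟩
      simp only at hp hz ⊢
      have := log_const cR (g := g p) (h := fun z => g p1 z + Complex.log ((cx z - cx p) / (cx z - cx p1)))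
        (hg p (hBL hp)) ((hg p1 hp1).add (ContinuousOn.clog ((cx_cont.sub continuous_const).continuousOn.div (cx_cont.sub continuous_const).continuousOn (hne p1 hp1)) (slit p hp))) ?_ hz hz0
      · linear_combination this
      · intro w hw
        rw [Complex.exp_add, hge p (hBL hp) w hw, hge p1 hp1 w hw, Complex.exp_log (Complex.slitPlane_ne_zero (slit p hp w hw))]
        have := hne p1 hp1 w hw
        field_simp
    have hBo : B ×ˢ R ∈ 𝓝 (p1, z1) := (Metric.isOpen_ball.prod hR).mem_nhds ⟨Metric.mem_ball_self (by linarith), hz1⟩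
    apply ContinuousAt.continuousWithinAt
    have hcon : ContinuousOn (fun q : Strip × Strip => (g p1 q.2 + Complex.log ((cx q.2 - cx q.1) / (cx q.2 - cx p1))) -
        (g p1 z0 + Complex.log ((cx z0 - cx q.1) / (cx z0 - cx p1))) + (h q.1 + Real.pi * Complex.I)) (B ×ˢ R) := by
      have c1 : Continuous (fun q : Strip × Strip => cx q.1) := cx_cont.comp continuous_fst
      have c2 : Continuous (fun q : Strip × Strip => cx q.2) := cx_cont.comp continuous_snd
      refine ContinuousOn.add (ContinuousOn.sub (ContinuousOn.add ?_ ?_) (ContinuousOn.add continuousOn_const ?_)) (ContinuousOn.add ?_ continuousOn_const)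
      · exact (hg p1 hp1).comp continuous_snd.continuousOn (fun q hq => hq.2)
      · exact ContinuousOn.clog ((c2.sub c1).continuousOn.div (c2.sub continuous_const).continuousOn (fun q hq => hne p1 hp1 _ hq.2))
          (fun q hq => slit _ hq.1 _ hq.2)
      · exact ContinuousOn.clog ((continuous_const.sub c1).continuousOn.div continuousOn_const (fun q hq => hne p1 hp1 _ hz0))
          (fun q hq => slit _ hq.1 _ hz0)
      · exact hh.comp continuous_fst.continuousOn (fun q hq => hBL hq.1)
    exact (hcon.continuousAt hBo).congr (by filter_upwards [hBo] with q hq using (eq q hq).symm)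
  · rintro ⟨p, z⟩ ⟨hp, hz⟩
    simp only at hp hz ⊢
    rw [Complex.exp_add, Complex.exp_sub, Complex.exp_add, hge p hp z hz, hge p hp z0 hz0, he p hp, Complex.exp_pi_mul_I]
    have := hne p hp z0 hz0
    field_simp
    ring

lemma conn_Ioo {α : Type*} [TopologicalSpace α] {S : Set α} (hS : IsPreconnected S) {t : α → ℝ} (ht : ContinuousOn t S)
    {a b : ℝ} (ha : ∀ s ∈ S, t s ≠ a) (hb : ∀ s ∈ S, t s ≠ b) {s0 : α} (h0 : s0 ∈ S) (h1 : t s0 ∈ Ioo a b) :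
    ∀ s ∈ S, t s ∈ Ioo a b := by
  intro s hs
  have := (hS.image t ht).ordConnected
  constructor
  · by_contra hcon
    push Not at hcon
    obtain ⟨q, hq, e⟩ := this.out ⟨s, hs, rfl⟩ ⟨s0, h0, rfl⟩ ⟨hcon, h1.1.le⟩
    exact ha q hq e
  · by_contra hcon
    push Not at hcon
    obtain ⟨q, hq, e⟩ := this.out ⟨s0, h0, rfl⟩ ⟨s, hs, rfl⟩ ⟨h1.2.le, hcon⟩
    exact hb q hq e

namespace Cx
variable {X Um Up : Set Ann} {η : II} (c : Cx X Um Up η)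
include c

lemma ang_exists (k : ℤ) : ∃ A : Strip × Strip → ℂ, ContinuousOn A (LL Up η k ×ˢ RR Up η k) ∧
    (∀ q ∈ LL Up η k ×ˢ RR Up η k, Complex.exp (A q) = cx q.2 - cx q.1) ∧
    ∀ x y : ℝ, x < k → k < y → (A ((x, tp), (y, tp))).im = 0 := by
  obtain ⟨A, hA, he⟩ := joint_log (c.LL_open k) (c.RR_open k) (LL_pre k) (RR_pre k) (c.LR_disj k)
    (c.LL_top (x := (k:ℝ) - 1/2) (by linarith)) rfl (c.RR_top (x := (k:ℝ) + 1/2) (by linarith)) rfl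
  set q0 : Strip × Strip := (((k:ℝ) - 1/2, tp), ((k:ℝ) + 1/2, tp)) with hq0
  have hq0m : q0 ∈ LL Up η k ×ˢ RR Up η k := ⟨c.LL_top (by linarith), c.RR_top (by linarith)⟩
  have e0 := he q0 hq0m
  have e1 : Complex.exp (A q0) = 1 := by
    rw [e0]; apply Complex.ext <;> simp [cx_re, cx_im, hq0]; norm_num
  refine ⟨fun q => A q - A q0, hA.sub continuousOn_const, ?_, ?_⟩
  · intro q hq
    rw [Complex.exp_sub, e1, he q hq, div_one]
  · intro x y hx hy
    set S : Set (ℝ × ℝ) := Iio (k:ℝ) ×ˢ Ioi (k:ℝ) with hS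
    have cS : IsPreconnected S := isPreconnected_Iio.prod isPreconnected_Ioi
    let j : ℝ × ℝ → Strip × Strip := fun s => ((s.1, tp), (s.2, tp))
    have hj : Continuous j := by fun_prop
    have hmap : MapsTo j S (LL Up η k ×ˢ RR Up η k) := fun s hs => ⟨c.LL_top hs.1, c.RR_top hs.2⟩
    have hval : ∀ s : ℝ × ℝ, cx (j s).2 - cx (j s).1 = ((s.2 - s.1 : ℝ) : ℂ) := by
      intro s; apply Complex.ext <;> simp [cx_re, cx_im, j]
    have hpos : ∀ s ∈ S, 0 < s.2 - s.1 := fun s hs => by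
      have h1 : s.1 < k := hs.1
      have h2 : k < s.2 := hs.2
      linarith
    have := log_const cS (g := fun s => A (j s)) (h := fun s => ((Real.log (s.2 - s.1) : ℝ) : ℂ))
      (hA.comp hj.continuousOn hmap) ?_ ?_ (z := (x, y)) (w := ((k:ℝ) - 1/2, (k:ℝ) + 1/2)) ⟨hx, hy⟩ ⟨by simp, by simp⟩
    · have h2 := congrArg Complex.im this
      simp only [Complex.sub_im, Complex.ofReal_im, sub_zero, j] at h2
      rw [Complex.sub_im, h2, hq0]; ring
    · refine Complex.continuous_ofReal.comp_continuousOn (ContinuousOn.log (by fun_prop) (fun s hs => (hpos s hs).ne'))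
    · intro s hs
      rw [he _ (hmap hs)]
      show cx (j s).2 - cx (j s).1 = _
      rw [hval, ← Complex.ofReal_exp, Real.exp_log (hpos s hs)]

lemma two_particle {α : Type*} [TopologicalSpace α] {C : Set α} (hC : IsPreconnected C) {u v : α → Strip}
    (hu : ContinuousOn u C) (hv : ContinuousOn v C) (hk : ∀ a ∈ C, ∃ k : ℤ, u a ∈ LL Up η k ∧ v a ∈ RR Up η k)
    (hlt : ∀ a ∈ C, (v a).1 < (u a).1) {a0 a1 : α} (h0 : a0 ∈ C) (hu0 : u a0 ∈ bet η {0})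
    (h1 : a1 ∈ C) (hv1 : v a1 ∈ bet η {0}) : False := by
  choose A hA hAe hAt using c.ang_exists
  have ov : ∀ k m : ℤ, k ≤ m → ∀ p ∈ LL Up η k, ∀ z ∈ RR Up η m, (A k (p, z)).im = (A m (p, z)).im := by
    intro k m hkm p hp z hz
    have s1 : LL Up η k ×ˢ RR Up η m ⊆ LL Up η k ×ˢ RR Up η k := prod_mono le_rfl (c.RR_mono hkm)
    have s2 : LL Up η k ×ˢ RR Up η m ⊆ LL Up η m ×ˢ RR Up η m := prod_mono (c.LL_mono hkm) le_rfl
    have hkm' : (k:ℝ) ≤ m := by exact_mod_cast hkm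
    have := log_const ((LL_pre k).prod (RR_pre m)) (g := A k) (h := A m) ((hA k).mono s1) ((hA m).mono s2)
      (fun q hq => by rw [hAe k q (s1 hq), hAe m q (s2 hq)]) (z := (p, z)) (w := (((k:ℝ) - 1/2, tp), ((m:ℝ) + 1/2, tp))) ⟨hp, hz⟩
      ⟨c.LL_top (by linarith), c.RR_top (by linarith)⟩
    have h2 := congrArg Complex.im this
    rw [Complex.sub_im, Complex.sub_im, hAt k _ _ (by linarith) (by linarith), hAt m _ _ (by linarith) (by linarith)] at h2
    linarith
  have ov' : ∀ k m : ℤ, ∀ p z, p ∈ LL Up η k → z ∈ RR Up η k → p ∈ LL Up η m → z ∈ RR Up η m →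
      (A k (p, z)).im = (A m (p, z)).im := by
    intro k m p z h1 h2 h3 h4
    rcases le_total k m with h | h
    · exact ov k m h p h1 z h4
    · exact (ov m k h p h3 z h2).symm
  choose! κ hκ using hk
  set θ : α → ℝ := fun a => (A (κ a) (u a, v a)).im with hθ
  have hθc : ContinuousOn θ C := by
    intro a ha
    obtain ⟨e1, e2⟩ := hκ a ha
    have hm : ∀ᶠ b in 𝓝[C] a, u b ∈ LL Up η (κ a) ∧ v b ∈ RR Up η (κ a) :=
      ((hu a ha).eventually ((c.LL_open _).mem_nhds e1)).and ((hv a ha).eventually ((c.RR_open _).mem_nhds e2))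
    have hca : ContinuousWithinAt (fun b => (A (κ a) (u b, v b)).im) C a := by
      refine Complex.continuous_im.continuousAt.comp_continuousWithinAt ?_
      have := (hA (κ a)).continuousAt (((c.LL_open _).prod (c.RR_open _)).mem_nhds (show (u a, v a) ∈ _ from ⟨e1, e2⟩))
      exact this.comp_continuousWithinAt (f := fun b => (u b, v b)) ((hu a ha).prodMk (hv a ha))
    refine hca.congr_of_eventuallyEq ?_ rfl
    filter_upwards [hm, self_mem_nhdsWithin] with b hb hbC
    exact ov' _ _ _ _ (hκ b hbC).1 (hκ b hbC).2 hb.1 hb.2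
  have hre : ∀ k, ∀ q ∈ LL Up η k ×ˢ RR Up η k, q.2.1 - q.1.1 = Real.exp (A k q).re * Real.cos (A k q).im := by
    intro k q hq
    have := congrArg Complex.re (hAe k q hq)
    rw [Complex.exp_re, Complex.sub_re, cx_re, cx_re] at this
    exact this.symm
  have him : ∀ k, ∀ q ∈ LL Up η k ×ˢ RR Up η k, (q.2.2:ℝ) - q.1.2 = Real.exp (A k q).re * Real.sin (A k q).im := by
    intro k q hq
    have := congrArg Complex.im (hAe k q hq)
    rw [Complex.exp_im, Complex.sub_im, cx_im, cx_im] at this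
    exact this.symm
  have hcos : ∀ a ∈ C, Real.cos (θ a) < 0 := by
    intro a ha
    have := hre _ (u a, v a) (hκ a ha)
    have h2 := hlt a ha
    simp only at this
    by_contra hcon
    push Not at hcon
    have := mul_nonneg (Real.exp_pos (A (κ a) (u a, v a)).re).le hcon
    simp only [hθ] at this
    linarith
  have hpi := Real.pi_pos
  have c0 : Real.cos (3 * Real.pi / 2) = 0 := by rw [Real.cos_eq_zero_iff]; exact ⟨1, by push_cast; ring⟩
  have s0 : Real.sin (3 * Real.pi / 2) = -1 := by
    rw [show 3 * Real.pi / 2 = Real.pi / 2 + Real.pi by ring, Real.sin_add_pi, Real.sin_pi_div_two]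
  have b0 : θ a0 < 0 := by
    obtain ⟨e1, e2⟩ := hκ a0 h0
    set k := κ a0 with hkdef
    have hk1 : 0 < k := by
      by_contra hcon
      push Not at hcon
      rcases hcon.eq_or_lt with h | h
      · rw [h] at e1; exact (LL_sub _ e1).2 hu0
      · exact c.LR_disj' le_rfl e1 (c.bet_RR h hu0)
    have hkr : (0:ℝ) < k := by exact_mod_cast hk1
    have hsub : bet η {0} ×ˢ RR Up η k ⊆ LL Up η k ×ˢ RR Up η k := prod_mono (c.bet_LL hk1) le_rfl
    have av : ∀ q ∈ bet η {0} ×ˢ RR Up η k, ¬ (Real.cos (A k q).im = 0 ∧ Real.sin (A k q).im = 1) := by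
      rintro ⟨p, z⟩ hq ⟨hc, hs⟩
      have i1 := hre k _ (hsub hq)
      have i2 := him k _ (hsub hq)
      rw [hc] at i1; rw [hs] at i2
      have i3 := Real.exp_pos (A k (p, z)).re
      simp only at i1 i2
      have hp : p ∈ bet η {0} := hq.1
      have hz : z ∈ bet η {0} := by
        obtain ⟨⟨m, hm, e⟩, h⟩ := hp
        refine ⟨⟨m, hm, by linarith⟩, ?_⟩
        have h' : (η:ℝ) < p.2 := h
        show (η:ℝ) < z.2
        linarith
      exact c.LR_disj' le_rfl (c.bet_LL hk1 hz) hq.2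
    have := conn_Ioo ((bet_pre 0).prod (RR_pre k)) (t := fun q => (A k q).im) (Complex.continuous_im.comp_continuousOn ((hA k).mono hsub))
      (a := -(3 * Real.pi / 2)) (b := Real.pi / 2) (fun q hq h => av q hq (by
        rw [h, Real.cos_neg, Real.sin_neg, c0, s0]; norm_num)) (fun q hq h => av q hq (by
        rw [h]; simp)) (s0 := (((0:ℝ), tp), ((k:ℝ) + 1/2, tp)))
      ⟨⟨⟨0, rfl, by simp⟩, c.eta_lt⟩, c.RR_top (by linarith)⟩ (by
        rw [hAt k _ _ hkr (by linarith)]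
        constructor <;> linarith) (u a0, v a0) ⟨hu0, e2⟩
    by_contra hcon
    push Not at hcon
    have h3 := hcos a0 h0
    have h4 : θ a0 < Real.pi / 2 := this.2
    exact absurd (Real.cos_nonneg_of_neg_pi_div_two_le_of_le (by linarith) h4.le) (not_le.2 h3)
  have b1 : 0 < θ a1 := by
    obtain ⟨e1, e2⟩ := hκ a1 h1
    set k := κ a1 with hkdef
    have hk1 : k < 0 := by
      by_contra hcon
      push Not at hcon
      rcases hcon.eq_or_lt with h | h
      · rw [← h] at e2; exact (RR_sub _ e2).2 hv1
      · exact c.LR_disj' le_rfl (c.bet_LL h hv1) e2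
    have hkr : (k:ℝ) < 0 := by exact_mod_cast hk1
    have hsub : LL Up η k ×ˢ bet η {0} ⊆ LL Up η k ×ˢ RR Up η k := prod_mono le_rfl (c.bet_RR hk1)
    have av : ∀ q ∈ LL Up η k ×ˢ bet η {0}, ¬ (Real.cos (A k q).im = 0 ∧ Real.sin (A k q).im = -1) := by
      rintro ⟨p, z⟩ hq ⟨hc, hs⟩
      have i1 := hre k _ (hsub hq)
      have i2 := him k _ (hsub hq)
      rw [hc] at i1; rw [hs] at i2
      have i3 := Real.exp_pos (A k (p, z)).re
      simp only at i1 i2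
      have hz : z ∈ bet η {0} := hq.2
      have hp : p ∈ bet η {0} := by
        obtain ⟨⟨m, hm, e⟩, h⟩ := hz
        refine ⟨⟨m, hm, by linarith⟩, ?_⟩
        have h' : (η:ℝ) < z.2 := h
        show (η:ℝ) < p.2
        linarith
      exact c.LR_disj' le_rfl hq.1 (c.bet_RR hk1 hp)
    have := conn_Ioo ((LL_pre k).prod (bet_pre 0)) (t := fun q => (A k q).im) (Complex.continuous_im.comp_continuousOn ((hA k).mono hsub))
      (a := -(Real.pi / 2)) (b := 3 * Real.pi / 2) (fun q hq h => av q hq (by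
        rw [h, Real.cos_neg, Real.sin_neg]; simp)) (fun q hq h => av q hq (by
        rw [h, c0, s0]; simp)) (s0 := (((k:ℝ) - 1/2, tp), ((0:ℝ), tp)))
      ⟨c.LL_top (by linarith), ⟨⟨0, rfl, by simp⟩, c.eta_lt⟩⟩ (by
        rw [hAt k _ _ (by linarith) hkr]
        constructor <;> linarith) (u a1, v a1) ⟨e1, hv1⟩
    by_contra hcon
    push Not at hcon
    have h3 := hcos a1 h1
    have h4 : -(Real.pi / 2) < θ a1 := this.1
    exact absurd (Real.cos_nonneg_of_neg_pi_div_two_le_of_le h4.le (by linarith)) (not_le.2 h3)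
  obtain ⟨a, ha, e⟩ := (hC.image θ hθc).ordConnected.out ⟨a0, h0, rfl⟩ ⟨a1, h1, rfl⟩ ⟨b0.le, b1.le⟩
  have := hcos a ha
  rw [e, Real.cos_zero] at this
  linarith

end Cx


structure GD (X Up : Set Ann) (G : Strip ≃ₜ Strip) (g : Ann → Ann) : Prop where
  cont : Continuous g
  sc : ∀ z, pr (G z) = g (pr z)
  T : ∀ (k : ℤ) z, G (shiftPt k z) = shiftPt k (G z)
  U : ∀ z, G z ∈ pr ⁻¹' Up ↔ z ∈ pr ⁻¹' Up
  X : ∀ z, pr (G z) ∈ X ↔ pr z ∈ X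

lemma quad {α : Type*} [TopologicalSpace α] {W P P' Q Q' A B : Set α} (hW : IsPreconnected W) (oP : IsOpen P) (oP' : IsOpen P')
    (oQ : IsOpen Q) (oQ' : IsOpen Q') (dP : Disjoint P P') (dQ : Disjoint Q Q')
    (hA : ∀ z ∈ W, z ∈ A ∨ z ∈ P ∨ z ∈ P') (hB : ∀ z ∈ W, z ∈ B ∨ z ∈ Q ∨ z ∈ Q')
    (hAQ : ∀ z ∈ W, z ∈ A → z ∈ Q') (hBP : (∀ z ∈ W, z ∈ B → z ∈ P) ∨ (∀ z ∈ W, z ∈ B → z ∈ P'))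
    {b w : α} (hb : b ∈ W) (hbB : b ∈ B) (hw : w ∈ W) (hwP : w ∈ P) (hwQ : w ∈ Q) :
    ∀ z ∈ W, z ∈ P' → z ∈ Q' := by
  rw [Set.disjoint_left] at dP dQ
  rcases hBP with hBP | hBP
  · have := hW.subset_left_of_subset_union (u := P ∪ Q') (v := P' ∩ Q) (oP.union oQ') (oP'.inter oQ) ?_ ?_ ⟨b, hb, Or.inl (hBP b hb hbB)⟩
    · intro z hz hP'
      rcases this hz with h | h
      · exact absurd hP' (dP h)
      · exact h
    · rw [Set.disjoint_left]; rintro z (h | h) ⟨h1, h2⟩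
      · exact dP h h1
      · exact dQ h2 h
    · intro z hz
      have h1 := hA z hz
      have h2 := hB z hz
      have h3 := hAQ z hz
      have h4 := hBP z hz
      simp only [mem_union, mem_inter_iff]
      tauto
  · exfalso
    have := hW.subset_left_of_subset_union (u := P' ∪ Q') (v := P ∩ Q) (oP'.union oQ') (oP.inter oQ) ?_ ?_ ⟨b, hb, Or.inl (hBP b hb hbB)⟩
    · rcases this hw with h | h
      · exact dP hwP h
      · exact dQ hwQ h
    · rw [Set.disjoint_left]; rintro z (h | h) ⟨h1, h2⟩
      · exact dP h1 h
      · exact dQ h2 h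
    · intro z hz
      have h1 := hA z hz
      have h2 := hB z hz
      have h3 := hAQ z hz
      have h4 := hBP z hz
      simp only [mem_union, mem_inter_iff]
      tauto

lemma vert_near {η b : II} (hb : η < b) (k : ℤ) {N : Set Strip} (hN : N ∈ 𝓝 (xk η k)) :
    ∃ y : II, η < y ∧ y < b ∧ ((k:ℝ), y) ∈ N := by
  obtain ⟨ε, hε, hh⟩ := Metric.mem_nhds_iff.1 hN
  have hb' : (η:ℝ) < b := hb
  have h1 := η.2.1
  have h2 := b.2.2
  set s := min ((b:ℝ) - η) ε / 2 with hs
  have s0 : 0 < min ((b:ℝ) - η) ε := lt_min (by linarith) hε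
  have s1 := min_le_left ((b:ℝ) - η) ε
  have s2 := min_le_right ((b:ℝ) - η) ε
  refine ⟨⟨(η:ℝ) + s, by linarith, by linarith⟩, ?_, ?_, hh ?_⟩
  · show (η:ℝ) < η + s
    linarith
  · show (η:ℝ) + s < b
    linarith
  · rw [Metric.mem_ball, dist_lt_iff]
    constructor
    · simpa [xk] using hε
    · show |(η:ℝ) + s - η| < ε
      rw [abs_lt]; constructor <;> linarith

namespace Cx
variable {X Um Up : Set Ann} {η : II} (c : Cx X Um Up η)
include c

lemma locate {z : Strip} (hz : z ∈ pr ⁻¹' Up) : ∃ i : ℤ, z ∈ LL Up η (i+1) ∧ z ∈ RR Up η (i-1) := by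
  obtain ⟨M, hM⟩ := c.compact_far (K := {z}) isCompact_singleton isPreconnected_singleton (by simpa using hz)
  have hR : ∀ k : ℤ, z ∈ LL Up η k → -M ≤ k := by
    intro k hk
    by_contra hcon
    push Not at hcon
    exact c.LR_disj' hcon.le hk ((hM M le_rfl).1 rfl)
  obtain ⟨i, hi, hmin⟩ := Int.exists_least_of_bdd (P := fun k => z ∈ LL Up η k) ⟨-M, hR⟩ ⟨M, (hM M le_rfl).2 rfl⟩
  refine ⟨i - 1, by simpa using hi, ?_⟩
  have hn : z ∉ LL Up η (i-1) := fun h => by have := hmin _ h; omega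
  by_cases hb : z ∈ bet η {i-1}
  · exact c.bet_RR (by omega) hb
  · rcases c.LR_cover ⟨hz, hb⟩ with h | h
    · exact absurd h hn
    · exact c.RR_mono (by omega) h

lemma core1 {G : Strip ≃ₜ Strip} {g : Ann → Ann} (hG : GD X Up G g) {j : ℤ} (hne : G (xk η 0) ≠ xk η j) {b : II} (hb : η < b) :
    ∃ O : Set Ann, IsOpen O ∧ X ⊆ O ∧
      (∀ z ∈ pr ⁻¹' (Up ∩ O), G.symm z ∈ bet η {0} → ∃ y, η < y ∧ y < b ∧ z = G ((0:ℝ), y)) ∧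
      ((∀ z ∈ pr ⁻¹' (Up ∩ O), z ∈ bet η {j} → G.symm z ∈ LL Up η 0) ∨
       (∀ z ∈ pr ⁻¹' (Up ∩ O), z ∈ bet η {j} → G.symm z ∈ RR Up η 0)) := by
  have cpt : ∀ (k : ℤ) (a : II), IsCompact ((fun y : II => (((k:ℝ), y) : Strip)) '' Ici a) := fun k a =>
    (isClosed_Ici.isCompact).image (by fun_prop)
  set B0 := G '' ((fun y : II => ((((0:ℤ):ℝ), y) : Strip)) '' Ici η) with hB0
  have cB0 : IsCompact B0 := (cpt 0 η).image G.continuous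
  have hnB : xk η j ∉ B0 := by
    rintro ⟨_, ⟨y, hy, rfl⟩, e⟩
    rcases (show η ≤ y from hy).eq_or_lt with h | h
    · subst h; exact hne e
    · exact c.xk_notU j (e ▸ (hG.U _).2 (c.vert_U h))
  have hN := cB0.isClosed.isOpen_compl.mem_nhds hnB
  obtain ⟨ε, hε, hh⟩ := Metric.mem_nhds_iff.1 hN
  obtain ⟨b', hb', hb'N⟩ : ∃ b' : II, η < b' ∧ ∀ y : II, η < y → y < b' → ((j:ℝ), y) ∉ B0 := by
    obtain ⟨b', h1, h2, h3⟩ := vert_near c.eta_lt j (Metric.ball_mem_nhds _ hε)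
    refine ⟨b', h1, fun y hy hy' => hh ?_⟩
    rw [Metric.mem_ball, dist_lt_iff] at h3 ⊢
    refine ⟨h3.1, ?_⟩
    have h4 := h3.2
    have hy1 : (η:ℝ) < y := hy
    have hy2 : (y:ℝ) < b' := hy'
    simp only [xk] at h4 ⊢
    rw [abs_lt] at h4 ⊢
    constructor <;> linarith
  set H := G '' ((fun y : II => ((((0:ℤ):ℝ), y) : Strip)) '' Ici b) ∪ (fun y : II => (((j:ℝ), y) : Strip)) '' Ici b' with hH
  have cH : IsCompact (pr '' H) := (((cpt 0 b).image G.continuous).union (cpt j b')).image pr_cont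
  refine ⟨(pr '' H)ᶜ, cH.isClosed.isOpen_compl, ?_, ?_, ?_⟩
  · rintro x hx ⟨z, hz, rfl⟩
    have : z ∈ pr ⁻¹' Up := by
      rcases hz with ⟨_, ⟨y, hy, rfl⟩, rfl⟩ | ⟨y, hy, rfl⟩
      · exact (hG.U _).2 (c.vert_U (hb.trans_le hy))
      · exact c.vert_U (hb'.trans_le hy)
    exact c.eac.notX_of_Up this hx
  · rintro z ⟨hzU, hzO⟩ ⟨⟨m, hm, e⟩, h⟩
    simp only [mem_singleton_iff] at hm
    subst hm
    refine ⟨(G.symm z).2, h, ?_, ?_⟩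
    · by_contra hcon
      push Not at hcon
      refine hzO ⟨z, Or.inl ⟨G.symm z, ⟨_, hcon, ?_⟩, by simp⟩, rfl⟩
      ext
      · exact e.symm
      · rfl
    · rw [eq_comm, ← G.apply_symm_apply z]
      congr 1
      simp only [Homeomorph.apply_symm_apply]
      ext
      · simpa using e.symm
      · rfl
  · set σ := (fun y : II => (((j:ℝ), y) : Strip)) '' Ioo η b' with hσ
    have σin : ∀ z ∈ pr ⁻¹' (Up ∩ (pr '' H)ᶜ), z ∈ bet η {j} → z ∈ σ := by
      rintro z ⟨hzU, hzO⟩ ⟨⟨m, hm, e⟩, h⟩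
      simp only [mem_singleton_iff] at hm
      subst hm
      have ez : (((m:ℝ), z.2) : Strip) = z := by
        ext
        · exact e.symm
        · rfl
      refine ⟨z.2, ⟨h, ?_⟩, ez⟩
      by_contra hcon
      push Not at hcon
      exact hzO ⟨z, Or.inr ⟨_, hcon, ez⟩, rfl⟩
    have cσ : IsPreconnected (G.symm '' σ) := by
      refine IsPreconnected.image ?_ _ G.symm.continuous.continuousOn
      have h := rect_preconn {(j:ℝ)} (Ioo (η:ℝ) b') ordConnected_singleton ordConnected_Ioo
      convert h using 1
      ext z
      constructor
      · rintro ⟨y, hy, rfl⟩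
        exact ⟨rfl, hy⟩
      · rintro ⟨h1, h2⟩
        refine ⟨z.2, h2, ?_⟩
        ext
        · exact h1.symm
        · rfl
    have sσ : G.symm '' σ ⊆ pr ⁻¹' Up \ bet η {0} := by
      rintro _ ⟨z, ⟨y, hy, rfl⟩, rfl⟩
      refine ⟨?_, ?_⟩
      · rw [← hG.U, G.apply_symm_apply]; exact c.vert_U hy.1
      · rintro ⟨⟨m, hm, e⟩, h⟩
        simp only [mem_singleton_iff] at hm
        subst hm
        refine hb'N y hy.1 hy.2 ⟨G.symm ((j:ℝ), y), ⟨_, h.le, ?_⟩, by simp⟩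
        ext
        · exact e.symm
        · rfl
    rcases (G.symm '' σ).eq_empty_or_nonempty with h0 | ⟨w, hw⟩
    · left
      intro z hz hzb
      exact absurd (mem_image_of_mem G.symm (σin z hz hzb)) (by rw [h0]; simp)
    · rcases c.LR_cover (sσ hw) with h | h
      · left
        exact fun z hz hzb => sub_LL cσ sσ hw h (mem_image_of_mem G.symm (σin z hz hzb))
      · right
        exact fun z hz hzb => sub_RR cσ sσ hw h (mem_image_of_mem G.symm (σin z hz hzb))

lemma near_pt {C : Set Ann} (hC : ∀ x ∈ X, ∀ᶠ a in 𝓝 x, a ∈ Up → a ∈ C) (k : ℤ) : ∃ z ∈ pr ⁻¹' C, z ∈ bet η {k} := by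
  have := pr_cont.continuousAt.eventually (hC _ (c.xk_mem k))
  obtain ⟨y, h1, h2, h3⟩ := vert_near c.eta_lt k this
  exact ⟨_, h3 (c.vert_U h1), ⟨k, rfl, rfl⟩, h1⟩

lemma GLo {G : Strip ≃ₜ Strip} {g : Ann → Ann} (hG : GD X Up G g) {z : Strip} (hz : z ∈ pr ⁻¹' Up) :
    z ∈ {z | G.symm z ∈ bet η {0}} ∨ z ∈ G.symm ⁻¹' LL Up η 0 ∨ z ∈ G.symm ⁻¹' RR Up η 0 := by
  have hU : G.symm z ∈ pr ⁻¹' Up := by rw [← hG.U, G.apply_symm_apply]; exact hz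
  by_cases h : G.symm z ∈ bet η {0}
  · exact Or.inl h
  · exact Or.inr (c.LR_cover ⟨hU, h⟩)

lemma far {C : Set Ann} (hCU : C ⊆ Up) {G : Strip ≃ₜ Strip} {g : Ann → Ann} (hG : GD X Up G g) (j : ℤ) {z : Strip} (hz : z ∈ pr ⁻¹' C) :
    (∃ w ∈ pr ⁻¹' C, w ∈ G.symm ⁻¹' LL Up η 0 ∧ w ∈ LL Up η j) ∧ (∃ w ∈ pr ⁻¹' C, w ∈ G.symm ⁻¹' RR Up η 0 ∧ w ∈ RR Up η j) := by
  have hzU : z ∈ pr ⁻¹' Up := hCU hz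
  have hU : G.symm z ∈ pr ⁻¹' Up := by rw [← hG.U, G.apply_symm_apply]; exact hzU
  obtain ⟨M1, h1⟩ := c.compact_far (K := {z}) isCompact_singleton isPreconnected_singleton (by simpa using hzU)
  obtain ⟨M2, h2⟩ := c.compact_far (K := {G.symm z}) isCompact_singleton isPreconnected_singleton (by simpa using hU)
  have Ts : ∀ k : ℤ, G.symm (shiftPt k z) = shiftPt k (G.symm z) := by
    intro k
    rw [Homeomorph.symm_apply_eq, hG.T, G.apply_symm_apply]
  have hC : ∀ k : ℤ, shiftPt k z ∈ pr ⁻¹' C := fun k => by rw [mem_preimage, pr_shift]; exact hz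
  set m := max M2 (max (M1 - j) (M1 + j)) with hm
  have m1 : M2 ≤ m := le_max_left _ _
  have m2 : M1 - j ≤ m := (le_max_left _ _).trans (le_max_right _ _)
  have m3 : M1 + j ≤ m := (le_max_right _ _).trans (le_max_right _ _)
  refine ⟨⟨shiftPt (-m) z, hC _, ?_, ?_⟩, ⟨shiftPt m z, hC _, ?_, ?_⟩⟩
  · rw [mem_preimage, Ts]
    have := c.LL_shift' (m := -m) ((h2 m m1).2 rfl)
    simpa using this
  · have := c.LL_shift' (m := -m) ((h1 (j+m) (by linarith)).2 rfl)
    simpa using this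
  · rw [mem_preimage, Ts]
    have := c.RR_shift' (m := m) ((h2 m m1).1 rfl)
    simpa using this
  · have := c.RR_shift' (m := m) ((h1 (m - j) (by linarith)).1 rfl)
    simpa using this

lemma jB {j : ℤ} {z : Strip} (hz : z ∈ pr ⁻¹' Up) : z ∈ bet η {j} ∨ z ∈ LL Up η j ∨ z ∈ RR Up η j := by
  by_cases h : z ∈ bet η {j}
  · exact Or.inl h
  · exact Or.inr (c.LR_cover ⟨hz, h⟩)

lemma core2R {G : Strip ≃ₜ Strip} {g : Ann → Ann} (hG : GD X Up G g) {b : II} (hb : η < b)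
    (ht : ∀ y, η < y → y < b → G ((0:ℝ), y) ∈ RR Up η 4) : ∃ N : Set Ann, IsOpen N ∧ X ⊆ N ∧
      ∀ z, pr z ∈ N → z ∈ pr ⁻¹' Up → G.symm z ∈ RR Up η 0 → z ∈ RR Up η 3 := by
  obtain ⟨j, hj, hne⟩ : ∃ j : ℤ, (j = 3 ∨ j = 4) ∧ G (xk η 0) ≠ xk η j := by
    by_cases h : G (xk η 0) = xk η 3
    · refine ⟨4, Or.inr rfl, ?_⟩
      rw [h]; intro e
      have := congrArg Prod.fst e
      simp [xk] at this
    · exact ⟨3, Or.inl rfl, h⟩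
  have j3 : 3 ≤ j := by omega
  have j4 : j ≤ 4 := by omega
  obtain ⟨O, oO, hXO, hA, hB⟩ := c.core1 hG hne hb
  obtain ⟨C, oC, hCO, pC, hC⟩ := c.eac.collar oO hXO
  have hsub : pr ⁻¹' C ⊆ pr ⁻¹' (Up ∩ O) := preimage_mono hCO
  obtain ⟨b1, hb1, hb1B⟩ := c.near_pt hC j
  obtain ⟨w, hw, hw1, hw2⟩ := (c.far (hCO.trans inter_subset_left) hG j hb1).1
  have key := quad pC ((c.LL_open 0).preimage G.symm.continuous) ((c.RR_open 0).preimage G.symm.continuous) (c.LL_open j) (c.RR_open j)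
    ((c.LR_disj 0).preimage _) (c.LR_disj j) (fun z hz => c.GLo hG (hsub hz).1) (fun z hz => c.jB (hsub hz).1)
    (fun z hz h => by
      obtain ⟨y, h1, h2, rfl⟩ := hA z (hsub hz) h
      exact c.RR_mono j4 (ht y h1 h2))
    (hB.imp (fun h z hz => h z (hsub hz)) (fun h z hz => h z (hsub hz))) hb1 hb1B hw hw1 hw2
  refine ⟨interior {a | a ∈ Up → a ∈ C}, isOpen_interior, fun x hx => mem_interior_iff_mem_nhds.2 (hC x hx), ?_⟩
  intro z hz hzU hR
  exact c.RR_mono j3 (key z ((interior_subset hz) hzU) hR)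

lemma core2L {G : Strip ≃ₜ Strip} {g : Ann → Ann} (hG : GD X Up G g) {b : II} (hb : η < b)
    (ht : ∀ y, η < y → y < b → G ((0:ℝ), y) ∈ LL Up η (-4)) : ∃ N : Set Ann, IsOpen N ∧ X ⊆ N ∧
      ∀ z, pr z ∈ N → z ∈ pr ⁻¹' Up → G.symm z ∈ LL Up η 0 → z ∈ LL Up η (-3) := by
  obtain ⟨j, hj, hne⟩ : ∃ j : ℤ, (j = -3 ∨ j = -4) ∧ G (xk η 0) ≠ xk η j := by
    by_cases h : G (xk η 0) = xk η (-3)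
    · refine ⟨-4, Or.inr rfl, ?_⟩
      rw [h]; intro e
      have := congrArg Prod.fst e
      simp [xk] at this
    · exact ⟨-3, Or.inl rfl, h⟩
  have j3 : j ≤ -3 := by omega
  have j4 : -4 ≤ j := by omega
  obtain ⟨O, oO, hXO, hA, hB⟩ := c.core1 hG hne hb
  obtain ⟨C, oC, hCO, pC, hC⟩ := c.eac.collar oO hXO
  have hsub : pr ⁻¹' C ⊆ pr ⁻¹' (Up ∩ O) := preimage_mono hCO
  obtain ⟨b1, hb1, hb1B⟩ := c.near_pt hC j
  obtain ⟨w, hw, hw1, hw2⟩ := (c.far (hCO.trans inter_subset_left) hG j hb1).2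
  have key := quad pC ((c.RR_open 0).preimage G.symm.continuous) ((c.LL_open 0).preimage G.symm.continuous) (c.RR_open j) (c.LL_open j)
    ((c.LR_disj 0).symm.preimage _) (c.LR_disj j).symm (fun z hz => (c.GLo hG (hsub hz).1).imp id Or.symm) (fun z hz => (c.jB (hsub hz).1).imp id Or.symm)
    (fun z hz h => by
      obtain ⟨y, h1, h2, rfl⟩ := hA z (hsub hz) h
      exact c.LL_mono j4 (ht y h1 h2))
    (hB.symm.imp (fun h z hz => h z (hsub hz)) (fun h z hz => h z (hsub hz))) hb1 hb1B hw hw1 hw2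
  refine ⟨interior {a | a ∈ Up → a ∈ C}, isOpen_interior, fun x hx => mem_interior_iff_mem_nhds.2 (hC x hx), ?_⟩
  intro z hz hzU hR
  exact c.LL_mono j3 (key z ((interior_subset hz) hzU) hR)

lemma back_pt {G : Strip ≃ₜ Strip} {g : Ann → Ann} (hG : GD X Up G g) {C : Set Ann} (hC : ∀ x ∈ X, ∀ᶠ a in 𝓝 x, a ∈ Up → a ∈ C) :
    ∃ z ∈ pr ⁻¹' C, G z ∈ bet η {0} := by
  have hx : pr (G.symm (xk η 0)) ∈ X := by rw [← hG.X, G.apply_symm_apply]; exact c.xk_mem 0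
  have := (pr_cont.comp G.symm.continuous).continuousAt.eventually (hC _ hx)
  obtain ⟨y, h1, h2, h3⟩ := vert_near c.eta_lt 0 this
  refine ⟨G.symm ((0:ℤ), y), h3 ?_, ?_⟩
  · show G.symm _ ∈ pr ⁻¹' Up
    rw [← hG.U, G.apply_symm_apply]; exact c.vert_U h1
  · rw [G.apply_symm_apply]; exact ⟨⟨0, rfl, rfl⟩, h1⟩

omit c in
lemma pr_img_open {P : Strip → Prop} (hP : IsOpen {z | P z}) (hs : ∀ k z, P z → P (shiftPt k z)) :
    ∃ O : Set Ann, IsOpen O ∧ ∀ z, pr z ∈ O ↔ P z := by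
  refine ⟨pr '' {z | P z}, pr_open _ hP, fun z => ⟨?_, fun h => ⟨z, h, rfl⟩⟩⟩
  rintro ⟨w, hw, e⟩
  obtain ⟨k, rfl⟩ := pr_eq e
  exact hs k w hw

lemma coreR {G : Strip ≃ₜ Strip} {g : Ann → Ann} (hG : GD X Up G g) {b : II} (hb : η < b)
    (ht : ∀ y, η < y → y < b → G ((0:ℝ), y) ∈ RR Up η 4) (hd : ∀ z, pr z ∈ X → (G z).1 < z.1) : False := by
  obtain ⟨N, oN, hXN, hN⟩ := c.core2R hG hb ht
  obtain ⟨D, oD, hD⟩ := pr_img_open (P := fun z => (G z).1 < z.1) (isOpen_lt (by fun_prop) (by fun_prop))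
    (fun k z h => by rw [hG.T]; simpa [shiftPt] using h)
  obtain ⟨C, oC, hCO, pC, hC⟩ := c.eac.collar (O := g ⁻¹' N ∩ D) ((oN.preimage hG.cont).inter oD) (by
    intro x hx
    obtain ⟨z, rfl⟩ := pr_surj x
    refine ⟨?_, (hD z).2 (hd z hx)⟩
    rw [mem_preimage, ← hG.sc]
    exact hXN ((hG.X z).2 hx))
  obtain ⟨a0, h0, h0'⟩ := c.near_pt hC 0
  obtain ⟨a1, h1, h1'⟩ := c.back_pt hG hC
  refine c.two_particle pC (u := id) (v := G) continuousOn_id G.continuous.continuousOn ?_ (fun z hz => (hD z).1 (hCO hz).2.2) h0 h0' h1 h1'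
  intro z hz
  have hzU : z ∈ pr ⁻¹' Up := (hCO hz).1
  obtain ⟨i, hi1, hi2⟩ := c.locate hzU
  refine ⟨i+1, hi1, ?_⟩
  have e1 : shiftPt (-(i-1)) z ∈ RR Up η 0 := by
    have := c.RR_shift' (m := -(i-1)) hi2
    simpa using this
  have e2 := hN (shiftPt (-(i-1)) (G z)) (by rw [pr_shift, hG.sc]; exact (hCO hz).2.1) (U_shift.2 ((hG.U z).2 hzU))
    (by rw [← hG.T, G.symm_apply_apply]; exact e1)
  have e3 := c.RR_shift' (m := i - 1) e2
  rw [shift_add] at e3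
  simp only [neg_add_cancel, add_neg_cancel, shift_zero] at e3
  exact c.RR_mono (by omega) e3

lemma coreL {G : Strip ≃ₜ Strip} {g : Ann → Ann} (hG : GD X Up G g) {b : II} (hb : η < b)
    (ht : ∀ y, η < y → y < b → G ((0:ℝ), y) ∈ LL Up η (-4)) (hd : ∀ z, pr z ∈ X → z.1 < (G z).1) : False := by
  obtain ⟨N, oN, hXN, hN⟩ := c.core2L hG hb ht
  obtain ⟨D, oD, hD⟩ := pr_img_open (P := fun z => z.1 < (G z).1) (isOpen_lt (by fun_prop) (by fun_prop))
    (fun k z h => by rw [hG.T]; simpa [shiftPt] using h)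
  obtain ⟨C, oC, hCO, pC, hC⟩ := c.eac.collar (O := g ⁻¹' N ∩ D) ((oN.preimage hG.cont).inter oD) (by
    intro x hx
    obtain ⟨z, rfl⟩ := pr_surj x
    refine ⟨?_, (hD z).2 (hd z hx)⟩
    rw [mem_preimage, ← hG.sc]
    exact hXN ((hG.X z).2 hx))
  obtain ⟨a0, h0, h0'⟩ := c.near_pt hC 0
  obtain ⟨a1, h1, h1'⟩ := c.back_pt hG hC
  refine c.two_particle pC (u := G) (v := id) G.continuous.continuousOn continuousOn_id ?_ (fun z hz => (hD z).1 (hCO hz).2.2) h1 h1' h0 h0'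
  intro z hz
  have hzU : z ∈ pr ⁻¹' Up := (hCO hz).1
  obtain ⟨i, hi1, hi2⟩ := c.locate hzU
  refine ⟨i-1, ?_, hi2⟩
  have e1 : shiftPt (-(i+1)) z ∈ LL Up η 0 := by
    have := c.LL_shift' (m := -(i+1)) hi1
    simpa using this
  have e2 := hN (shiftPt (-(i+1)) (G z)) (by rw [pr_shift, hG.sc]; exact (hCO hz).2.1) (U_shift.2 ((hG.U z).2 hzU))
    (by rw [← hG.T, G.symm_apply_apply]; exact e1)
  have e3 := c.LL_shift' (m := i + 1) e2
  rw [shift_add] at e3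
  simp only [neg_add_cancel, add_neg_cancel, shift_zero] at e3
  exact c.LL_mono (by omega) e3

end Cx


namespace GD
variable {X Up : Set Ann}
lemma idd : GD X Up (Homeomorph.refl Strip) id :=
  ⟨continuous_id, fun _ => rfl, fun _ _ => rfl, fun _ => Iff.rfl, fun _ => Iff.rfl⟩
lemma comp {G H : Strip ≃ₜ Strip} {g h : Ann → Ann} (hG : GD X Up G g) (hH : GD X Up H h) : GD X Up (G.trans H) (h ∘ g) := by
  refine ⟨hH.cont.comp hG.cont, fun z => ?_, fun k z => ?_, fun z => ?_, fun z => ?_⟩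
  · simp [hH.sc, hG.sc]
  · simp [hH.T, hG.T]
  · rw [Homeomorph.trans_apply, hH.U, hG.U]
  · rw [Homeomorph.trans_apply, hH.X, hG.X]
lemma sh (m : ℤ) : GD X Up (shiftH m) id := by
  refine ⟨continuous_id, fun z => pr_shift m z, fun k z => ?_, fun z => U_shift', fun z => ?_⟩
  · show shiftPt m (shiftPt k z) = shiftPt k (shiftPt m z)
    rw [shift_add, shift_add, add_comm]
  · show pr (shiftPt m z) ∈ X ↔ _
    rw [pr_shift]
where
  U_shift' {m : ℤ} {z : Strip} : shiftPt m z ∈ pr ⁻¹' Up ↔ z ∈ pr ⁻¹' Up := by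
    rw [mem_preimage, pr_shift, mem_preimage]
lemma iter {G : Strip ≃ₜ Strip} {g : Ann → Ann} (hG : GD X Up G g) (n : ℕ) :
    ∃ (H : Strip ≃ₜ Strip) (h : Ann → Ann), GD X Up H h ∧ ⇑H = G^[n] := by
  induction n with
  | zero => exact ⟨_, _, idd, rfl⟩
  | succ n ih =>
    obtain ⟨H, h, hH, e⟩ := ih
    refine ⟨_, _, hH.comp hG, ?_⟩
    rw [iterate_succ', ← e]; rfl
end GD

lemma GD_of {X Um Up : Set Ann} (hX : IsEAC X Um Up) (f : Ann ≃ₜ Ann) (hf : IsotopicToId ⇑f)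
    (F : Strip ≃ₜ Strip) (hF : IsLift ⇑f ⇑F) (hinv : ⇑f '' X = X) : GD X Up F f := by
  have T1 := hF.2
  have Tm : ∀ z, F (shiftPt (-1) z) = shiftPt (-1) (F z) := by
    intro z
    have := T1 (shiftPt (-1) z)
    rw [shift_add] at this
    have h2 := congrArg (shiftPt (-1)) this
    rw [shift_add] at h2
    simp only [neg_add_cancel, add_neg_cancel, shift_zero] at h2
    exact h2.symm
  refine ⟨f.continuous, hF.1, fun k z => ?_, fun z => ?_, fun z => ?_⟩
  · induction k using Int.induction_on generalizing z with
    | zero => simp [shift_zero]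
    | succ k ih =>
      have e : ∀ w, shiftPt ((k:ℤ) + 1) w = shiftPt 1 (shiftPt k w) := fun w => by rw [shift_add, add_comm]
      rw [e, T1, ih, ← e]
    | pred k ih =>
      have e : ∀ w, shiftPt (-(k:ℤ) - 1) w = shiftPt (-1) (shiftPt (-k) w) := fun w => by rw [shift_add]; congr 1; ring
      rw [e, Tm, ih, ← e]
  · rw [mem_preimage, hF.1]; exact f_Up hX f hf hinv _
  · rw [hF.1]
    constructor
    · intro h
      rw [← hinv] at h
      obtain ⟨a, ha, e⟩ := h
      rwa [← f.injective e]
    · intro h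
      rw [← hinv]; exact ⟨_, h, rfl⟩

namespace Cx
variable {X Um Up : Set Ann} {η : II} (c : Cx X Um Up η)
include c

lemma tailG {G : Strip ≃ₜ Strip} {g : Ann → Ann} (hG : GD X Up G g) : ∃ k : ℤ, AccIdxB 1 (pr ⁻¹' Up) (G (xk η 0)) (xk η 0) k ∧
    ∃ b : II, η < b ∧ ∀ y, η < y → y < b → G ((0:ℝ), y) ∈ RR Up η (k-1) ∧ G ((0:ℝ), y) ∈ LL Up η (k+1) := by
  have hη' : (η:ℝ) < 1 := c.eta_lt
  have hη1 := η.2.1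
  set p : ℝ → II := fun t => projIcc (-1:ℝ) 1 (by norm_num) (1 - t * (1 - η)) with hp
  have hpv : ∀ t ∈ Icc (0:ℝ) 1, (p t : ℝ) = 1 - t * (1 - η) := by
    intro t ht
    have h1 : t * (1 - η) ≤ 1 * (1 - η) := mul_le_mul_of_nonneg_right ht.2 (by linarith)
    have h2 : 0 ≤ t * (1 - η) := mul_nonneg ht.1 (by linarith)
    simp only [hp]
    rw [projIcc_of_mem _ ⟨by linarith, by linarith⟩]
  have hpc : Continuous p := continuous_projIcc.comp (by fun_prop)
  have hgt : ∀ t ∈ Ico (0:ℝ) 1, η < p t := by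
    intro t ht
    show (η:ℝ) < p t
    rw [hpv t ⟨ht.1, ht.2.le⟩]
    have h1 : t * (1 - η) < 1 * (1 - η) := mul_lt_mul_of_pos_right ht.2 (by linarith)
    linarith
  have q0 : ContinuousOn (fun t => G ((0:ℝ), p t)) (Icc 0 1) := by
    exact (G.continuous.comp (continuous_const.prodMk hpc)).continuousOn
  have q1 : InjOn (fun t => G ((0:ℝ), p t)) (Icc 0 1) := by
    intro s hs t ht e
    have e1 := congrArg Prod.snd (G.injective e)
    have e2 : (p s : ℝ) = p t := congrArg Subtype.val e1
    rw [hpv s hs, hpv t ht] at e2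
    have hpos : 1 - (η:ℝ) ≠ 0 := by linarith
    apply mul_right_cancel₀ hpos
    linarith
  have q2 : (fun t => G ((0:ℝ), p t)) 1 = G (xk η 0) := by
    have : p 1 = η := by
      apply Subtype.ext
      rw [hpv 1 ⟨by norm_num, le_rfl⟩]; ring
    simp only [this, xk, Int.cast_zero]
  have q3 : pr (G (xk η 0)) ∈ X := by
    rw [hG.X]; exact c.xk_mem 0
  have q4 : ∀ t ∈ Ico (0:ℝ) 1, (fun t => G ((0:ℝ), p t)) t ∈ pr ⁻¹' Up := by
    intro t ht
    rw [hG.U]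
    have := c.vert_U (k := 0) (hgt t ht)
    simpa using this
  obtain ⟨k, hk, t0, ht0, hh⟩ := c.index q0 q1 q2 q3 q4
  refine ⟨k, hk, p t0, hgt t0 ht0, fun y h1 h2 => ?_⟩
  have h1' : (η:ℝ) < y := h1
  have h2' : (y:ℝ) < p t0 := h2
  rw [hpv t0 ⟨ht0.1, ht0.2.le⟩] at h2'
  have hpos : 0 < 1 - (η:ℝ) := by linarith
  have hs : (1 - (y:ℝ)) / (1 - η) ∈ Ico t0 1 := by
    constructor
    · rw [le_div_iff₀ hpos]; linarith
    · rw [div_lt_one hpos]; linarith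
  have e : p ((1 - (y:ℝ)) / (1 - η)) = y := by
    apply Subtype.ext
    rw [hpv _ ⟨ht0.1.trans hs.1, hs.2.le⟩]
    field_simp
    ring
  have := hh _ hs
  rwa [e] at this

lemma acc : AccFrom (pr ⁻¹' Up) (xk η 0) := by
  obtain ⟨γ, h, -, -⟩ := (vert_arc c.eta_lt 0).toArc (U := pr ⁻¹' Up) (fun z hz hne => c.bet_U _ (c.Bv_U hz hne))
  exact ⟨γ, h⟩

lemma topo {F : Strip ≃ₜ Strip} {f : Ann → Ann} (hF : GD X Up F f) {ρ : ℝ}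
    (hrot : PrimeEndRotB 1 (pr ⁻¹' Up) (pr ⁻¹' X) ⇑F ρ) {ε : ℝ} (hε : 0 < ε) (N0 : ℕ) :
    (∃ n ≥ N0, 1 ≤ n ∧ ∃ z, pr z ∈ X ∧ n * (ρ - ε) ≤ (F^[n] z).1 - z.1) ∧
    (∃ n ≥ N0, 1 ≤ n ∧ ∃ z, pr z ∈ X ∧ (F^[n] z).1 - z.1 ≤ n * (ρ + ε)) := by
  choose H h hH hHe using fun n => hF.iter n
  choose k hk b hb ht using fun n => c.tailG (hH n)
  have lim := hrot _ (c.xk_mem 0) _ (c.xk_mem 0) c.acc c.acc k (fun n => by have := hk n; rwa [hHe] at this)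
  have hball := lim.eventually (Metric.ball_mem_nhds ρ (show 0 < ε / 2 by linarith))
  obtain ⟨N1, hN1⟩ := exists_nat_gt (10 / ε)
  obtain ⟨n, hn, hn0, hn1, hn2⟩ := (hball.and ((eventually_ge_atTop N0).and ((eventually_ge_atTop 1).and (eventually_ge_atTop N1)))).exists
  have hnpos : (0:ℝ) < n := by exact_mod_cast hn1
  have h10 : 10 < n * ε := by
    rw [div_lt_iff₀ hε] at hN1
    have : (N1:ℝ) ≤ n := by exact_mod_cast hn2
    nlinarith
  rw [Real.dist_eq, abs_lt] at hn
  have hlo : (ρ - ε/2) * n < k n := (lt_div_iff₀ hnpos).1 (by linarith [hn.1])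
  have hhi : k n < (ρ + ε/2) * n := (div_lt_iff₀ hnpos).1 (by linarith [hn.2])
  constructor
  · by_contra hcon
    push Not at hcon
    refine c.coreR ((hH n).comp (GD.sh (-(k n - 5)))) (hb n) (fun y h1 h2 => ?_) (fun z hz => ?_)
    · have := c.RR_shift' (m := -(k n - 5)) (ht n y h1 h2).1
      have e : k n - 1 + -(k n - 5) = 4 := by ring
      rw [e] at this
      exact this
    · have := hcon n hn0 hn1 z hz
      rw [← hHe] at this
      show (H n z).1 + ((-(k n - 5) : ℤ) : ℝ) < z.1
      push_cast
      nlinarith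
  · by_contra hcon
    push Not at hcon
    refine c.coreL ((hH n).comp (GD.sh (-(k n + 5)))) (hb n) (fun y h1 h2 => ?_) (fun z hz => ?_)
    · have := c.LL_shift' (m := -(k n + 5)) (ht n y h1 h2).2
      have e : k n + 1 + -(k n + 5) = -4 := by ring
      rw [e] at this
      exact this
    · have := hcon n hn0 hn1 z hz
      rw [← hHe] at this
      show z.1 < (H n z).1 + ((-(k n + 5) : ℤ) : ℝ)
      push_cast
      nlinarith

end Cx


open scoped ENNReal NNReal BoundedContinuousFunction

lemma avg_meas (f : Ann → Ann) (x : Ann) {n : ℕ} (hn : 1 ≤ n) : ∃ μ : ProbabilityMeasure Ann, ∀ h : Ann → ℝ, Continuous h →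
    ∫ a, h a ∂(μ : Measure Ann) = (∑ j ∈ Finset.range n, h (f^[j] x)) / n := by
  have h0 : (n:ℝ≥0∞) ≠ 0 := by simp; omega
  refine ⟨⟨(n:ℝ≥0∞)⁻¹ • ∑ j ∈ Finset.range n, Measure.dirac (f^[j] x), ⟨?_⟩⟩, fun h hh => ?_⟩
  · rw [Measure.smul_apply, Measure.finset_sum_apply]
    simp
    exact ENNReal.inv_mul_cancel h0 (by simp)
  · show ∫ a, h a ∂((n:ℝ≥0∞)⁻¹ • ∑ j ∈ Finset.range n, Measure.dirac (f^[j] x)) = _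
    rw [integral_smul_measure, integral_finset_sum_measure]
    · simp only [integral_dirac]
      simp [div_eq_inv_mul]
    · intro i hi
      exact integrable_dirac (by simp)

lemma KB (f : Ann ≃ₜ Ann) {X : Set Ann} (hX : IsClosed X) (hinv : ∀ a ∈ X, f a ∈ X) (φ : Ann → ℝ) (hφ : Continuous φ) (ρ : ℝ)
    (H : ∀ ε > 0, ∀ N0 : ℕ, ∃ n ≥ N0, 1 ≤ n ∧ ∃ x ∈ X, n * (ρ - ε) ≤ ∑ j ∈ Finset.range n, φ (f^[j] x)) :
    ∃ μ : Measure Ann, IsProbabilityMeasure μ ∧ Measure.map f μ = μ ∧ μ Xᶜ = 0 ∧ ρ ≤ ∫ a, φ a ∂μ := by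
  choose n hn hn1 x hx hS using fun i : ℕ => H (1 / ((i:ℝ) + 1)) (by positivity) i
  choose μ hμ using fun i => avg_meas f (x i) (hn1 i)
  let 𝒰 : Ultrafilter ℕ := hyperfilter ℕ
  have hU : (𝒰 : Filter ℕ) ≤ atTop := by
    rw [← Nat.cofinite_eq_atTop]; exact hyperfilter_le_cofinite
  have lim0 : ∃ ν : ProbabilityMeasure Ann, Tendsto μ 𝒰 (𝓝 ν) := by
    obtain ⟨ν, -, h⟩ := isCompact_univ.ultrafilter_le_nhds (𝒰.map μ) (by simp)
    exact ⟨ν, h⟩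
  obtain ⟨ν, hν⟩ := lim0
  have lim : ∀ h : Ann → ℝ, Continuous h → Tendsto (fun i => (∑ j ∈ Finset.range (n i), h (f^[j] (x i))) / n i) 𝒰 (𝓝 (∫ a, h a ∂(ν : Measure Ann))) := by
    intro h hh
    have := (ProbabilityMeasure.tendsto_iff_forall_integral_tendsto.1 hν) (BoundedContinuousFunction.mkOfCompact ⟨h, hh⟩)
    simp only [BoundedContinuousFunction.mkOfCompact_apply, ContinuousMap.coe_mk] at this
    refine this.congr (fun i => ?_)
    exact hμ i h hh
  have hnpos : ∀ i, (0:ℝ) < n i := fun i => by exact_mod_cast hn1 i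
  refine ⟨ν, inferInstance, ?_, ?_, ?_⟩
  · have : IsProbabilityMeasure (Measure.map f (ν : Measure Ann)) := Measure.isProbabilityMeasure_map f.continuous.aemeasurable
    refine ext_of_forall_integral_eq_of_IsFiniteMeasure (fun h => ?_)
    rw [integral_map f.continuous.aemeasurable h.continuous.aestronglyMeasurable]
    have l1 := lim (fun a => h (f a)) (h.continuous.comp f.continuous)
    have l2 := lim h h.continuous
    have l3 := l1.sub l2
    have l4 : Tendsto (fun i => (∑ j ∈ Finset.range (n i), h (f (f^[j] (x i)))) / n i - (∑ j ∈ Finset.range (n i), h (f^[j] (x i))) / n i) 𝒰 (𝓝 0) := by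
      have hb : Tendsto (fun i : ℕ => 2 * ‖h‖ / ((i:ℝ))) atTop (𝓝 0) := tendsto_const_nhds.div_atTop tendsto_natCast_atTop_atTop
      refine squeeze_zero_norm' ?_ (hb.mono_left hU)
      filter_upwards [hU (eventually_ge_atTop 1)] with i hi
      have hi' : (0:ℝ) < i := by exact_mod_cast hi
      have e : (∑ j ∈ Finset.range (n i), h (f (f^[j] (x i)))) - (∑ j ∈ Finset.range (n i), h (f^[j] (x i))) = h (f^[n i] (x i)) - h (x i) := by
        rw [← Finset.sum_sub_distrib]
        have := Finset.sum_range_sub (fun j => h (f^[j] (x i))) (n i)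
        simp only [iterate_succ', comp_apply] at this
        simpa using this
      rw [← sub_div, e, norm_div]
      have h1 := h.norm_coe_le_norm (f^[n i] (x i))
      have h2 := h.norm_coe_le_norm (x i)
      have h3 := norm_sub_le (h (f^[n i] (x i))) (h (x i))
      have h4 : (i:ℝ) ≤ ‖(n i : ℝ)‖ := by
        rw [Real.norm_of_nonneg (hnpos i).le]; exact_mod_cast hn i
      gcongr
      linarith
    have := tendsto_nhds_unique l3 l4
    linarith
  · have hXne : X.Nonempty := ⟨_, hx 0⟩
    have l := lim (fun a => Metric.infDist a X) (Metric.continuous_infDist_pt X)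
    have hit : ∀ i j, f^[j] (x i) ∈ X := by
      intro i j
      induction j with
      | zero => exact hx i
      | succ j ih => rw [iterate_succ']; exact hinv _ ih
    have e0 : ∫ a, Metric.infDist a X ∂(ν : Measure Ann) = 0 := by
      refine tendsto_nhds_unique l ?_
      have : (fun i => (∑ j ∈ Finset.range (n i), Metric.infDist (f^[j] (x i)) X) / (n i : ℝ)) = fun _ => 0 := by
        funext i
        rw [Finset.sum_eq_zero (fun j _ => Metric.infDist_zero_of_mem (hit i j)), zero_div]
      rw [this]; exact tendsto_const_nhds
    have hintg : Integrable (fun a => Metric.infDist a X) (ν : Measure Ann) :=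
      (BoundedContinuousFunction.mkOfCompact ⟨fun a => Metric.infDist a X, Metric.continuous_infDist_pt X⟩).integrable _
    rw [integral_eq_zero_iff_of_nonneg (fun a => Metric.infDist_nonneg) hintg] at e0
    rw [← nonpos_iff_eq_zero]
    refine (measure_mono ?_).trans_eq (ae_iff.1 e0)
    intro a ha h
    apply ha
    exact (hX.mem_iff_infDist_zero hXne).2 h
  · have l := lim φ hφ
    have l5 : Tendsto (fun i : ℕ => ρ - 1 / ((i:ℝ) + 1)) 𝒰 (𝓝 (ρ - 0)) :=
      (tendsto_const_nhds.sub tendsto_one_div_add_atTop_nhds_zero_nat).mono_left hU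
    rw [sub_zero] at l5
    refine le_of_tendsto_of_tendsto' l5 l (fun i => ?_)
    rw [le_div_iff₀ (hnpos i), mul_comm]
    exact hS i

lemma convex_rot (f : Ann ≃ₜ Ann) {X : Set Ann} (φ : Ann → ℝ) (hφ : Continuous φ) (ρ : ℝ) {μ ν : Measure Ann}
    [IsProbabilityMeasure μ] [IsProbabilityMeasure ν] (h1 : Measure.map f μ = μ) (h2 : Measure.map f ν = ν)
    (h3 : μ Xᶜ = 0) (h4 : ν Xᶜ = 0) (h5 : ρ ≤ ∫ a, φ a ∂μ) (h6 : ∫ a, φ a ∂ν ≤ ρ) : ρ ∈ rotMes f φ X := by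
  obtain ⟨s, t, hs, ht, hst, e⟩ : ρ ∈ segment ℝ (∫ a, φ a ∂ν) (∫ a, φ a ∂μ) := by
    rw [segment_eq_Icc (h6.trans h5)]; exact ⟨h6, h5⟩
  have int : ∀ (κ : Measure Ann) [IsFiniteMeasure κ], Integrable φ κ := fun κ _ =>
    (BoundedContinuousFunction.mkOfCompact ⟨φ, hφ⟩).integrable κ
  refine ⟨ENNReal.ofReal s • ν + ENNReal.ofReal t • μ, ⟨?_⟩, ?_, ?_, ?_⟩
  · simp [← ENNReal.ofReal_add hs ht, hst]
  · rw [Measure.map_add _ _ f.continuous.measurable, Measure.map_smul, Measure.map_smul, h1, h2]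
  · simp [h3, h4]
  · rw [integral_add_measure ((int ν).smul_measure ENNReal.ofReal_ne_top) ((int μ).smul_measure ENNReal.ofReal_ne_top),
      integral_smul_measure, integral_smul_measure, ENNReal.toReal_ofReal hs, ENNReal.toReal_ofReal ht]
    exact e

/-- Matsumoto's theorem -- the upper prime end rotation number belongs to the
measure-theoretic rotation set `ρ_mes(f̃, X)`. -/
theorem matsumoto_upper
    (f : Ann ≃ₜ Ann) (hf : IsotopicToId ⇑f)
    (F : Strip ≃ₜ Strip) (hF : IsLift ⇑f ⇑F)
    (X Um Up : Set Ann) (hX : IsEAC X Um Up) (hinv : ⇑f '' X = X)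
    (φ : Ann → ℝ) (hφc : Continuous φ)
    (hφ : ∀ z : Strip, φ (pr z) = (F z).1 - z.1)
    (ρp : ℝ)
    (hrot : PrimeEndRotB 1 (pr ⁻¹' Up) (pr ⁻¹' X) ⇑F ρp) :
    ρp ∈ rotMes ⇑f φ X := by

  obtain ⟨η, c⟩ := exists_eta hX
  have hG := GD_of hX f hf F hF hinv
  have hi : ∀ a ∈ X, f a ∈ X := fun a ha => by rw [← hinv]; exact ⟨a, ha, rfl⟩
  have it : ∀ (n : ℕ) z, pr (F^[n] z) = f^[n] (pr z) := by
    intro n z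
    induction n with
    | zero => rfl
    | succ n ih => rw [iterate_succ', comp_apply, hF.1, ih, iterate_succ', comp_apply]
  have bir : ∀ (n : ℕ) z, ∑ j ∈ Finset.range n, φ (f^[j] (pr z)) = (F^[n] z).1 - z.1 := by
    intro n z
    have := Finset.sum_range_sub (fun j => (F^[j] z).1) n
    simp only [iterate_succ', comp_apply, iterate_zero, id_eq] at this
    rw [← this]
    exact Finset.sum_congr rfl (fun j _ => by rw [← it, hφ])
  obtain ⟨μ, hμ, m1, m2, m3⟩ := KB f hX.compact.isClosed hi φ hφc ρp (fun ε hε N0 => by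
    obtain ⟨n, h1, h2, z, hz, h⟩ := (c.topo hG hrot hε N0).1
    exact ⟨n, h1, h2, _, hz, by rw [bir]; exact h⟩)
  obtain ⟨ν, hν, n1, n2, n3⟩ := KB f hX.compact.isClosed hi (fun a => - φ a) hφc.neg (-ρp) (fun ε hε N0 => by
    obtain ⟨n, h1, h2, z, hz, h⟩ := (c.topo hG hrot hε N0).2
    exact ⟨n, h1, h2, _, hz, by rw [Finset.sum_neg_distrib, bir]; linarith⟩)
  rw [integral_neg] at n3
  exact convex_rot f φ hφc ρp m1 n1 m2 n2 m3 (by linarith)
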